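/- arXiv:1411.0339 — 4 statements merged into one kernel-verified Lean document; each statement's English description precedes it below -/
import Mathlib

section
/- Let s = 2k > 2 be even. Then the s-core of κ_{s−1,s+1}, the unique (s−1,s+1)-core partition of maximal size, is the empty partition. -/
/-- A partition: a weakly decreasing sequence of natural numbers (indexed from 0)
that is eventually zero.  `parts i` is the (i+1)-st largest part (0 if `i` exceeds
the number of parts). -/
structure NPartition where
  parts : ℕ → ℕ
  antitone : ∀ ⦃i j : ℕ⦄, i ≤ j → parts j ≤ parts i
  eventually_zero : ∃ N, ∀ i, N ≤ i → parts i = 0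

namespace NPartition

/-- The size of a partition: the sum of its parts. -/
noncomputable def size (lam : NPartition) : ℕ := ∑ᶠ i, lam.parts i

/-- The number of (positive) parts of a partition. -/
noncomputable def numParts (lam : NPartition) : ℕ := sInf {N | lam.parts N = 0}

/-- The conjugate partition: `conj.parts j` is the number of rows whose part exceeds `j`,
i.e. the length of column `j` of the Young diagram. -/
noncomputable def conj (lam : NPartition) : NPartition where
  parts := fun j => ((Finset.range lam.numParts).filter (fun i => j < lam.parts i)).card
  antitone := by
    intro a b hab
    apply Finset.card_le_card
    intro x hx
    simp only [Finset.mem_filter] at hx ⊢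
    exact ⟨hx.1, lt_of_le_of_lt hab hx.2⟩
  eventually_zero := by
    refine ⟨lam.parts 0, fun j hj => ?_⟩
    simp only [Finset.card_eq_zero, Finset.filter_eq_empty_iff]
    intro i _
    exact not_lt.mpr (le_trans (lam.antitone (Nat.zero_le i)) hj)

/-- The hook length of the box in row `i`, column `j` (both 0-indexed) of the Young
diagram: arm + leg + 1. -/
noncomputable def hookLength (lam : NPartition) (i j : ℕ) : ℕ :=
  (lam.parts i - (j + 1)) + (lam.conj.parts j - (i + 1)) + 1

/-- `lam` is an `s`-core: no box of its Young diagram has hook length `s`. -/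
noncomputable def IsCore (s : ℕ) (lam : NPartition) : Prop :=
  ∀ i j, j < lam.parts i → lam.hookLength i j ≠ s

/-- The empty partition. -/
def emptyP : NPartition := ⟨fun _ => 0, fun _ _ _ => le_rfl, ⟨0, fun _ _ => rfl⟩⟩

/-- The parts of the partition obtained from `lam` by removing the (rim) hook with
corner box `(i, j)` (0-indexed). -/
noncomputable def removeHookParts (lam : NPartition) (i j : ℕ) : ℕ → ℕ := fun r =>
  if r < i then lam.parts r
  else if r + 1 < lam.conj.parts j then lam.parts (r + 1) - 1
  else if r + 1 = lam.conj.parts j then j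
  else lam.parts r

/-- `mu` is obtained from `lam` by removing a single hook of length `s`. -/
noncomputable def RemoveHookStep (s : ℕ) (lam mu : NPartition) : Prop :=
  ∃ i j, j < lam.parts i ∧ lam.hookLength i j = s ∧
    ∀ r, mu.parts r = lam.removeHookParts i j r

/-- `core` is the `s`-core of `lam`: it is obtained from `lam` by repeatedly removing
hooks of length `s`, and no hook of length `s` remains. -/
noncomputable def HasSCore (s : ℕ) (lam core : NPartition) : Prop :=
  Relation.ReflTransGen (RemoveHookStep s) lam core ∧ IsCore s core

/-- The bead-set of `lam` with shift `k`: the set `{0, …, k-1} ∪ {h + k : h a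
first-column hook length of `lam`}`.  (The first-column hook length of row `i`
(0-indexed) is `parts i + (m - (i+1))` where `m` is the number of parts.) -/
noncomputable def beadSet (lam : NPartition) (k : ℕ) : Finset ℕ :=
  Finset.range k ∪ (Finset.range lam.numParts).image
    (fun i => lam.parts i + (lam.numParts - (i + 1)) + k)

/-- `X` is a bead-set for `lam`. -/
noncomputable def IsBeadSet (lam : NPartition) (X : Finset ℕ) : Prop :=
  ∃ k, X = lam.beadSet k

/-- The minimal bead-set of `lam` (shift `k = 0`), i.e. its set of first-column
hook lengths. -/
noncomputable def minBeadSet (lam : NPartition) : Finset ℕ := lam.beadSet 0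

/-- `X` is the bead-set of `lam` normalized with respect to `s`: the size of `X`
is divisible by `s`, with the least possible shift `k`. -/
noncomputable def IsNormalizedBeadSet (s : ℕ) (lam : NPartition) (X : Finset ℕ) : Prop :=
  ∃ k, X = lam.beadSet k ∧ (lam.beadSet k).card % s = 0 ∧
    ∀ k' < k, (lam.beadSet k').card % s ≠ 0

end NPartition

/-- Runner `i` of the `s`-abacus of the bead-set `X`:  `X_i = {j : i + j·s ∈ X}`. -/
def runner (s i : ℕ) (X : Finset ℕ) : Finset ℕ :=
  (Finset.range (X.sup id + 1)).filter (fun j => i + j * s ∈ X)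

/-- The staircase partition `τ_ℓ = (ℓ, ℓ-1, …, 1)`. -/
def staircase (l : ℕ) : NPartition :=
  ⟨fun i => l - i, fun _ _ hij => Nat.sub_le_sub_left hij l,
   ⟨l, fun i hi => Nat.sub_eq_zero_of_le hi⟩⟩

/-- `P_{s,t}`: the set of positive integers not expressible as a nonnegative integer
combination of `s` and `t`. -/
def Pst (s t : ℕ) : Set ℕ := {n | 0 < n ∧ ¬ ∃ a b : ℕ, n = a * s + b * t}



namespace NPartition

lemma parts_eq_zero_iff' (lam : NPartition) (i : ℕ) : lam.parts i = 0 ↔ lam.numParts ≤ i := by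
  have hne : {N | lam.parts N = 0}.Nonempty := by
    obtain ⟨N, hN⟩ := lam.eventually_zero
    exact ⟨N, hN N le_rfl⟩
  constructor
  · intro h
    exact Nat.sInf_le h
  · intro h
    have h1 : lam.parts lam.numParts = 0 := Nat.sInf_mem hne
    have := lam.antitone h
    omega

lemma lt_conj_iff (lam : NPartition) (i j : ℕ) : i < lam.conj.parts j ↔ j < lam.parts i := by
  have hdef : lam.conj.parts j =
    ((Finset.range lam.numParts).filter (fun i => j < lam.parts i)).card := rfl
  rw [hdef]
  constructor
  · intro h
    by_contra hc
    have : ((Finset.range lam.numParts).filter (fun i => j < lam.parts i)) ⊆ Finset.range i := by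
      intro x hx
      simp only [Finset.mem_filter, Finset.mem_range] at hx ⊢
      by_contra hxi
      have := lam.antitone (not_lt.mp hxi)
      omega
    have := Finset.card_le_card this
    simp only [Finset.card_range] at this
    omega
  · intro h
    have : Finset.range (i+1) ⊆
        ((Finset.range lam.numParts).filter (fun i => j < lam.parts i)) := by
      intro x hx
      simp only [Finset.mem_filter, Finset.mem_range] at hx ⊢
      have h1 := lam.antitone (show x ≤ i by omega)
      refine ⟨?_, by omega⟩
      by_contra hc
      have := (lam.parts_eq_zero_iff' x).2 (by omega)
      omega
    have := Finset.card_le_card this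
    simp only [Finset.card_range] at this
    omega

/-- the bead of row `i` in the `N`-bead configuration -/
def bead (N : ℕ) (lam : NPartition) (i : ℕ) : ℕ := lam.parts i + (N - 1 - i)

/-- the `N`-bead configuration -/
def beads (N : ℕ) (lam : NPartition) : Finset ℕ := (Finset.range N).image (bead N lam)

lemma bead_lt {N : ℕ} {lam : NPartition} {i j : ℕ} (hij : i < j) (hj : j < N) :
    bead N lam j < bead N lam i := by
  unfold bead
  have := lam.antitone hij.le
  omega

lemma bead_injOn (N : ℕ) (lam : NPartition) :
    Set.InjOn (bead N lam) (Finset.range N : Set ℕ) := by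
  intro i hi j hj h
  simp only [Finset.coe_range, Set.mem_Iio] at hi hj
  rcases lt_trichotomy i j with h1 | h1 | h1
  · have := bead_lt (lam := lam) h1 hj; omega
  · exact h1
  · have := bead_lt (lam := lam) h1 hi; omega

lemma mem_beads {N : ℕ} {lam : NPartition} {x : ℕ} :
    x ∈ beads N lam ↔ ∃ i < N, lam.parts i + (N - 1 - i) = x := by
  simp [beads, bead]

lemma card_beads (N : ℕ) (lam : NPartition) : (beads N lam).card = N := by
  rw [beads, Finset.card_image_of_injOn (bead_injOn N lam), Finset.card_range]

lemma sum_beads {M : Type*} [AddCommMonoid M] (N : ℕ) (lam : NPartition) (f : ℕ → M) :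
    ∑ x ∈ beads N lam, f x = ∑ i ∈ Finset.range N, f (bead N lam i) := by
  rw [beads, Finset.sum_image (bead_injOn N lam)]

lemma exists_of_notMem_beads {N : ℕ} {lam : NPartition} (hN : lam.parts N = 0) {y : ℕ}
    (hy : y ∉ beads N lam) : ∃ j, y + lam.conj.parts j = N + j := by
  have hex : ∃ i, N ≤ i ∨ lam.parts i + (N - 1 - i) < y := ⟨N, Or.inl le_rfl⟩
  classical
  have h1 := Nat.find_spec hex
  set i := Nat.find hex
  have hiN : i ≤ N := Nat.find_min' hex (Or.inl le_rfl)
  have hge : N ≤ y + i := by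
    rcases h1 with h1 | h1 <;> omega
  have hz : i = N → lam.parts i = 0 := by intro h; rw [h]; exact hN
  refine ⟨y + i - N, ?_⟩
  have hle : lam.parts i ≤ y + i - N := by
    rcases h1 with h1 | h1
    · rw [hz (by omega)]; omega
    · omega
  have hA : ¬ i < lam.conj.parts (y + i - N) := by
    rw [lt_conj_iff]; omega
  have hB : i ≤ lam.conj.parts (y + i - N) := by
    rcases Nat.eq_zero_or_pos i with h0 | h0
    · omega
    · have h2 := Nat.find_min hex (m := i - 1) (by omega)
      have h3 : y ≠ lam.parts (i-1) + (N - 1 - (i-1)) := by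
        intro h
        exact hy (mem_beads.2 ⟨i-1, by omega, h.symm⟩)
      have : i - 1 < lam.conj.parts (y + i - N) := by
        rw [lt_conj_iff]; omega
      omega
  omega

lemma notMem_beads {N : ℕ} {lam : NPartition} {y j : ℕ}
    (h : y + lam.conj.parts j = N + j) : y ∉ beads N lam := by
  intro hy
  obtain ⟨i, hi, rfl⟩ := mem_beads.1 hy
  have := lam.lt_conj_iff i j
  by_cases hc : j < lam.parts i
  · have := this.2 hc
    omega
  · have : ¬ i < lam.conj.parts j := fun h => hc (this.1 h)
    omega

lemma core_closed {N a : ℕ} {lam : NPartition} (hN : lam.parts N = 0) (ha : 0 < a)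
    (hc : IsCore a lam) {x : ℕ} (hx : x ∈ beads N lam) (hax : a ≤ x) :
    x - a ∈ beads N lam := by
  by_contra hcon
  obtain ⟨j, hj⟩ := exists_of_notMem_beads hN hcon
  obtain ⟨i, hi, rfl⟩ := mem_beads.1 hx
  have h1 := lam.lt_conj_iff i j
  have hji : j < lam.parts i := by
    by_contra hc
    have : ¬ i < lam.conj.parts j := fun h => hc (h1.1 h)
    omega
  have h2 := h1.2 hji
  refine hc i j hji ?_
  unfold hookLength
  omega

lemma conj_le {N : ℕ} {lam : NPartition} (hN : lam.parts N = 0) (j : ℕ) :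
    lam.conj.parts j ≤ N := by
  have := lam.lt_conj_iff N j
  by_contra h
  have := this.1 (by omega)
  omega

lemma lt_of_parts_pos {N : ℕ} {lam : NPartition} (hN : lam.parts N = 0) {i j : ℕ}
    (h : j < lam.parts i) : i < N := by
  by_contra hc
  have := lam.antitone (not_lt.1 hc)
  omega

lemma closed_core {N a : ℕ} {lam : NPartition} (hN : lam.parts N = 0)
    (hc : ∀ x ∈ beads N lam, a ≤ x → x - a ∈ beads N lam) : IsCore a lam := by
  intro i j hji hh
  have h2 := (lam.lt_conj_iff i j).2 hji
  have hL := conj_le hN j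
  have hiN := lt_of_parts_pos hN hji
  unfold hookLength at hh
  refine notMem_beads (N := N) (lam := lam) (y := N + j - lam.conj.parts j) (j := j) (by omega) ?_
  have := hc (lam.parts i + (N - 1 - i)) (mem_beads.2 ⟨i, hiN, rfl⟩) (by omega)
  convert this using 1
  omega

lemma exists_of_finset (X : Finset ℕ) :
    ∃ lam : NPartition, lam.parts X.card = 0 ∧ beads X.card lam = X := by
  induction X using Finset.induction_on_max with
  | empty => exact ⟨emptyP, rfl, by simp [beads]⟩
  | insert m X hm ih =>
    obtain ⟨lam, h0, hX⟩ := ih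
    have hmX : m ∉ X := fun h => lt_irrefl _ (hm m h)
    have hcard : (insert m X).card = X.card + 1 := Finset.card_insert_of_notMem hmX
    have hle : X.card + lam.parts 0 ≤ m := by
      rcases Nat.eq_zero_or_pos X.card with hz | hz
      · rw [hz] at h0; omega
      · have h1 : lam.parts 0 + (X.card - 1 - 0) ∈ beads X.card lam :=
          mem_beads.2 ⟨0, hz, rfl⟩
        rw [hX] at h1
        have := hm _ h1
        omega
    refine ⟨⟨fun i => Nat.casesOn i (m - X.card) lam.parts, ?_, ?_⟩, ?_, ?_⟩
    · intro i j hij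
      rcases i with _ | i <;> rcases j with _ | j
      · exact le_rfl
      · have := lam.antitone (Nat.zero_le j)
        show lam.parts j ≤ m - X.card
        omega
      · omega
      · exact lam.antitone (by omega)
    · obtain ⟨M, hM⟩ := lam.eventually_zero
      refine ⟨M + 1, fun i hi => ?_⟩
      rcases i with _ | i
      · omega
      · exact hM i (by omega)
    · rw [hcard]; exact h0
    · rw [hcard]
      ext x
      rw [mem_beads, Finset.mem_insert]
      have hxX : x ∈ X ↔ ∃ i < X.card, lam.parts i + (X.card - 1 - i) = x := by
        rw [← mem_beads, hX]
      rw [hxX]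
      constructor
      · rintro ⟨i, hi, h⟩
        rcases i with _ | i
        · left
          replace h : m - X.card + (X.card + 1 - 1 - 0) = x := h
          omega
        · right
          refine ⟨i, by omega, ?_⟩
          replace h : lam.parts i + (X.card + 1 - 1 - (i + 1)) = x := h
          omega
      · rintro (h | ⟨i, hi, h⟩)
        · refine ⟨0, by omega, ?_⟩
          show m - X.card + (X.card + 1 - 1 - 0) = x
          omega
        · refine ⟨i + 1, by omega, ?_⟩
          show lam.parts i + (X.card + 1 - 1 - (i + 1)) = x
          omega

lemma size_eq {N : ℕ} {lam : NPartition} (hN : lam.parts N = 0) :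
    lam.size = ∑ i ∈ Finset.range N, lam.parts i := by
  unfold size
  apply finsum_eq_sum_of_support_subset
  intro i hi
  simp only [Function.mem_support] at hi
  simp only [Finset.coe_range, Set.mem_Iio]
  exact lt_of_parts_pos hN (Nat.pos_of_ne_zero hi)

lemma sum_beads_id {N : ℕ} {lam : NPartition} (hN : lam.parts N = 0) :
    ∑ x ∈ beads N lam, x = lam.size + ∑ i ∈ Finset.range N, (N - 1 - i) := by
  rw [sum_beads N lam (fun x => x), size_eq hN, ← Finset.sum_add_distrib]
  rfl

/-- Removing an `s`-hook. -/
lemma exists_remove {N s i j : ℕ} {lam : NPartition} (hN : lam.parts N = 0)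
    (hji : j < lam.parts i) (hh : lam.hookLength i j = s) :
    ∃ mu : NPartition, RemoveHookStep s lam mu ∧ mu.parts N = 0 ∧ mu.size + s = lam.size ∧
      ∀ f : ℕ → ℕ, (∀ x, f (x + s) = f x) →
        ∑ x ∈ beads N mu, f x = ∑ x ∈ beads N lam, f x := by
  have h2 := (lam.lt_conj_iff i j).2 hji
  have hL := conj_le hN j
  have hiN := lt_of_parts_pos hN hji
  have hh' := hh
  unfold hookLength at hh'
  set L := lam.conj.parts j with hLdef
  have key : ∀ r, r < L ↔ j < lam.parts r := fun r => lam.lt_conj_iff r j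
  have hform : ∀ r, lam.removeHookParts i j r = if r < i then lam.parts r
    else if r + 1 < L then lam.parts (r + 1) - 1
    else if r + 1 = L then j else lam.parts r := fun r => rfl
  let mu : NPartition := ⟨lam.removeHookParts i j, by
    intro r r' hr
    have a1 := lam.antitone hr
    have a2 := lam.antitone (show r + 1 ≤ r' + 1 by omega)
    have a3 := lam.antitone (show r' ≤ r' + 1 by omega)
    have k1 := key r
    have k2 := key r'
    have k3 := key (r+1)
    have k4 := key (r'+1)
    rw [hform, hform]
    split_ifs <;> omega, by
    refine ⟨N, fun r hr => ?_⟩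
    have a1 := lam.antitone hr
    rw [hform]
    split_ifs <;> omega⟩
  have hmu : ∀ r, mu.parts r = if r < i then lam.parts r
    else if r + 1 < L then lam.parts (r + 1) - 1
    else if r + 1 = L then j else lam.parts r := fun r => rfl
  have hmuN : mu.parts N = 0 := by
    rw [hmu]
    split_ifs <;> omega
  have hb : ∀ f : ℕ → ℕ,
      ∑ r ∈ Finset.range N, f (bead N mu r) + f (bead N lam i) =
      ∑ r ∈ Finset.range N, f (bead N lam r) + f (bead N lam i - s) := by
    intro f
    rw [← Finset.add_sum_erase _ (fun r => f (bead N lam r)) (Finset.mem_range.2 hiN),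
      ← Finset.add_sum_erase _ (fun r => f (bead N mu r)) (Finset.mem_range.2
        (show L - 1 < N by omega))]
    have e1 : bead N mu (L - 1) = bead N lam i - s := by
      unfold bead
      rw [hmu]
      split_ifs <;> omega
    have e2 : ∑ r ∈ (Finset.range N).erase (L-1), f (bead N mu r) =
        ∑ r ∈ (Finset.range N).erase i, f (bead N lam r) := by
      refine Finset.sum_bij' (fun r _ => if i ≤ r ∧ r + 1 < L then r + 1 else r)
        (fun r _ => if i < r ∧ r < L then r - 1 else r) ?_ ?_ ?_ ?_ ?_
      · intro r hr
        simp only [Finset.mem_erase, Finset.mem_range] at hr ⊢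
        split_ifs <;> omega
      · intro r hr
        simp only [Finset.mem_erase, Finset.mem_range] at hr ⊢
        split_ifs <;> omega
      · intro r hr
        simp only [Finset.mem_erase, Finset.mem_range] at hr ⊢
        split_ifs <;> omega
      · intro r hr
        simp only [Finset.mem_erase, Finset.mem_range] at hr ⊢
        split_ifs <;> omega
      · intro r hr
        simp only [Finset.mem_erase, Finset.mem_range] at hr ⊢
        congr 1
        unfold bead
        rw [hmu]
        have k3 := key (r+1)
        split_ifs <;> omega
    rw [e1, e2]
    ring
  have hbs : s ≤ bead N lam i := by
    unfold bead
    omega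
  refine ⟨mu, ⟨i, j, hji, hh, fun r => rfl⟩, hmuN, ?_, ?_⟩
  · have h3 := hb (fun x => x)
    rw [← sum_beads N mu (fun x => x), ← sum_beads N lam (fun x => x), sum_beads_id hmuN,
      sum_beads_id hN] at h3
    omega
  · intro f hf
    have h3 := hb f
    rw [← sum_beads, ← sum_beads] at h3
    have := hf (bead N lam i - s)
    rw [Nat.sub_add_cancel hbs] at this
    omega

end NPartition

section Quad

set_option linter.unusedSectionVars false

/-- number of elements of `X` congruent to `r` mod `a` -/
def cnt (a : ℕ) (X : Finset ℕ) (r : ℕ) : ℕ := (X.filter (fun x => x % a = r)).card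

/-- closed under subtracting `a` -/
def ClosedSub (a : ℕ) (X : Finset ℕ) : Prop := ∀ x ∈ X, a ≤ x → x - a ∈ X

lemma ClosedSub.mul {a : ℕ} {X : Finset ℕ} (h : ClosedSub a X) {r q : ℕ} :
    ∀ n, r + a * (q + n) ∈ X → r + a * q ∈ X := by
  intro n
  induction n with
  | zero => intro h; simpa using h
  | succ n ih =>
    intro hx
    apply ih
    have := h _ hx (by nlinarith)
    convert this using 1
    rw [← add_assoc q n 1, mul_add a (q+n) 1]
    omega

lemma filter_eq_image {a : ℕ} (ha : 0 < a) {X : Finset ℕ} (h : ClosedSub a X) {r : ℕ}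
    (hr : r < a) :
    X.filter (fun x => x % a = r) = (Finset.range (cnt a X r)).image (fun q => r + a * q) := by
  -- the set of quotients
  set Q := (X.filter (fun x => x % a = r)).image (fun x => x / a) with hQ
  have hXQ : X.filter (fun x => x % a = r) = Q.image (fun q => r + a * q) := by
    ext x
    simp only [hQ, Finset.mem_image, Finset.mem_filter]
    constructor
    · rintro ⟨hx, hxr⟩
      exact ⟨x / a, ⟨x, ⟨hx, hxr⟩, rfl⟩, by rw [← hxr]; exact Nat.mod_add_div x a⟩
    · rintro ⟨q, ⟨y, ⟨hy, hyr⟩, rfl⟩, rfl⟩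
      rw [← hyr, Nat.mod_add_div]
      exact ⟨hy, rfl⟩
  have hinj : Function.Injective (fun q => r + a * q) := by
    intro q q' h
    have : a * q = a * q' := by simpa using h
    exact Nat.eq_of_mul_eq_mul_left ha this
  have hcard : cnt a X r = Q.card := by
    unfold cnt
    rw [hXQ, Finset.card_image_of_injective _ hinj]
  have hmemQ : ∀ q, q ∈ Q ↔ r + a * q ∈ X := by
    intro q
    have h1 : r + a * q ∈ X ↔ r + a * q ∈ X.filter (fun x => x % a = r) := by
      rw [Finset.mem_filter, Nat.add_mul_mod_self_left, Nat.mod_eq_of_lt hr]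
      simp
    rw [h1, hXQ]
    constructor
    · intro hq; exact Finset.mem_image_of_mem _ hq
    · intro hq
      obtain ⟨q1, hq1, h2⟩ := Finset.mem_image.1 hq
      exact hinj h2 ▸ hq1
  have hdown : ∀ q q', q ≤ q' → q' ∈ Q → q ∈ Q := by
    intro q q' hqq hq'
    rw [hmemQ] at hq' ⊢
    apply h.mul (q' - q)
    rwa [Nat.add_sub_cancel' hqq]
  have hQr : Q = Finset.range Q.card := by
    apply Finset.eq_of_subset_of_card_le
    · intro q hq
      rw [Finset.mem_range]
      have : Finset.range (q+1) ⊆ Q := by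
        intro p hp
        rw [Finset.mem_range] at hp
        exact hdown p q (by omega) hq
      have := Finset.card_le_card this
      rw [Finset.card_range] at this
      omega
    · simp
  rw [hXQ, hcard, ← hQr]

lemma mem_iff_lt_cnt {a : ℕ} (ha : 0 < a) {X : Finset ℕ} (h : ClosedSub a X) (x : ℕ) :
    x ∈ X ↔ x / a < cnt a X (x % a) := by
  have h1 : x ∈ X ↔ x ∈ X.filter (fun y => y % a = x % a) := by simp
  rw [h1, filter_eq_image ha h (Nat.mod_lt x ha), Finset.mem_image]
  constructor
  · rintro ⟨q, hq, hqx⟩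
    rw [Finset.mem_range] at hq
    have : x / a = q := by
      conv_lhs => rw [← hqx]
      rw [Nat.add_mul_div_left _ _ ha, Nat.div_eq_of_lt (Nat.mod_lt x ha), zero_add]
    rwa [this]
  · intro hx
    exact ⟨x / a, Finset.mem_range.2 hx, Nat.mod_add_div x a⟩

lemma sum_closed {a : ℕ} (ha : 0 < a) {X : Finset ℕ} (h : ClosedSub a X) (f : ℕ → ℤ) :
    ∑ x ∈ X, f x = ∑ r ∈ Finset.range a, ∑ q ∈ Finset.range (cnt a X r), f (r + a * q) := by
  have hmaps : ∀ x ∈ X, x % a ∈ Finset.range a := fun x _ => Finset.mem_range.2 (Nat.mod_lt x ha)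
  rw [← Finset.sum_fiberwise_of_maps_to hmaps]
  refine Finset.sum_congr rfl fun r hr => ?_
  rw [filter_eq_image ha h (Finset.mem_range.1 hr), Finset.sum_image]
  intro q _ q' _ h
  have : a * q = a * q' := by simpa using h
  exact Nat.eq_of_mul_eq_mul_left ha this

/-- first gap on runner `r` -/
def gap (a : ℕ) (X : Finset ℕ) (r : ZMod a) : ℤ := r.val + a * cnt a X r.val

lemma sum_zmod_val {M : Type*} [AddCommMonoid M] (a : ℕ) [NeZero a] (f : ℕ → M) :
    ∑ r : ZMod a, f r.val = ∑ r ∈ Finset.range a, f r := by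
  refine Finset.sum_bij' (fun r _ => r.val) (fun r _ => (r : ZMod a)) ?_ ?_ ?_ ?_ ?_
  · intro r _; exact Finset.mem_range.2 (ZMod.val_lt r)
  · intro r _; exact Finset.mem_univ _
  · intro r _; simp
  · intro r hr; exact ZMod.val_cast_of_lt (Finset.mem_range.1 hr)
  · intro r _; rfl

lemma sum_gap (a : ℕ) [NeZero a] {X : Finset ℕ} (h : ClosedSub a X) :
    ∑ r, gap a X r = ∑ r ∈ Finset.range a, (r : ℤ) + a * X.card := by
  have ha : 0 < a := Nat.pos_of_ne_zero (NeZero.ne a)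
  have h1 := sum_closed ha h (fun _ => 1)
  simp only [Finset.sum_const, Finset.card_range, nsmul_eq_mul, mul_one] at h1
  rw [h1]
  unfold gap
  rw [sum_zmod_val a (fun r => (r : ℤ) + a * cnt a X r), Finset.sum_add_distrib, Finset.mul_sum]

lemma sum_gap_sq (a : ℕ) [NeZero a] {X : Finset ℕ} (h : ClosedSub a X) :
    ∑ r, gap a X r ^ 2 = ∑ r ∈ Finset.range a, (r : ℤ) ^ 2 + a ^ 2 * X.card
      + 2 * a * ∑ x ∈ X, (x : ℤ) := by
  have ha : 0 < a := Nat.pos_of_ne_zero (NeZero.ne a)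
  have h1 := sum_closed ha h (fun x => ((x : ℤ) + a) ^ 2 - (x : ℤ) ^ 2)
  have h2 : ∑ x ∈ X, (((x : ℤ) + a) ^ 2 - (x : ℤ) ^ 2) = a ^ 2 * X.card
      + 2 * a * ∑ x ∈ X, (x : ℤ) := by
    rw [Finset.mul_sum, mul_comm, ← nsmul_eq_mul, ← Finset.sum_const, ← Finset.sum_add_distrib]
    refine Finset.sum_congr rfl fun x _ => by ring
  rw [h2] at h1
  rw [add_assoc, h1, ← Finset.sum_add_distrib]
  unfold gap
  rw [sum_zmod_val a (fun r => ((r : ℤ) + a * cnt a X r) ^ 2)]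
  refine Finset.sum_congr rfl fun r _ => ?_
  have := Finset.sum_range_sub (fun q : ℕ => ((r : ℤ) + a * q) ^ 2) (cnt a X r)
  have h3 : ∑ q ∈ Finset.range (cnt a X r),
      ((((r + a * q : ℕ) : ℤ) + a) ^ 2 - ((r + a * q : ℕ) : ℤ) ^ 2) =
      ∑ i ∈ Finset.range (cnt a X r), (((r : ℤ) + a * ((i + 1 : ℕ) : ℤ)) ^ 2 - ((r : ℤ) + a * i) ^ 2) := by
    refine Finset.sum_congr rfl fun q _ => ?_
    push_cast
    ring
  rw [h3, this]
  push_cast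
  ring

lemma mem_iff_lt_gap (a : ℕ) [NeZero a] {X : Finset ℕ} (h : ClosedSub a X) (x : ℕ) :
    x ∈ X ↔ (x : ℤ) < gap a X (x : ZMod a) := by
  have ha : 0 < a := Nat.pos_of_ne_zero (NeZero.ne a)
  rw [mem_iff_lt_cnt ha h, gap, ZMod.val_natCast]
  have h1 : (x : ℤ) = (x % a : ℕ) + a * (x / a : ℕ) := by
    exact_mod_cast (Nat.mod_add_div x a).symm
  have ha' : (0 : ℤ) < a := by exact_mod_cast ha
  conv_rhs => lhs; rw [h1]
  rw [add_lt_add_iff_left, mul_lt_mul_iff_right₀ ha', Nat.cast_lt]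

lemma gap_nonneg (a : ℕ) (X : Finset ℕ) (r : ZMod a) : 0 ≤ gap a X r := by
  unfold gap; positivity

lemma gap_cast (a : ℕ) [NeZero a] (X : Finset ℕ) (r : ZMod a) : ((gap a X r : ℤ) : ZMod a) = r := by
  unfold gap; simp

lemma exists_t (a b : ℕ) [NeZero a] {X : Finset ℕ} (h : ClosedSub a X) (hb : ClosedSub b X) :
    ∃ t : ZMod a → ℤ, (∀ r, 0 ≤ t r) ∧
      ∀ r, gap a X (r + b) = gap a X r + b - a * t r := by
  have ha : 0 < a := Nat.pos_of_ne_zero (NeZero.ne a)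
  have ha' : (0 : ℤ) < a := by exact_mod_cast ha
  have key : ∀ r : ZMod a, ∃ t : ℤ, 0 ≤ t ∧ gap a X (r + b) = gap a X r + b - a * t := by
    intro r
    obtain ⟨y, hy⟩ := Int.eq_ofNat_of_zero_le (gap_nonneg a X r)
    have hyr : (y : ZMod a) = r := by
      have := gap_cast a X r
      rw [hy] at this
      simpa using this
    have hyX : y ∉ X := by
      rw [mem_iff_lt_gap a h, hyr, hy]; simp
    have hybX : y + b ∉ X := by
      intro hc
      have := hb _ hc (by omega)
      simp at this
      exact hyX this
    rw [mem_iff_lt_gap a h] at hybX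
    push_cast at hybX
    rw [hyr, not_lt] at hybX
    have hdvd : (a : ℤ) ∣ gap a X r + b - gap a X (r + b) := by
      rw [← ZMod.intCast_zmod_eq_zero_iff_dvd]
      push_cast
      rw [gap_cast, gap_cast]
      ring
    obtain ⟨t, ht⟩ := hdvd
    refine ⟨t, ?_, by linarith⟩
    have : 0 ≤ (a : ℤ) * t := by rw [← ht, hy]; linarith
    exact nonneg_of_mul_nonneg_right this ha'
  choose t h1 h2 using key
  exact ⟨t, h1, h2⟩

/-- partial sums -/
def tau (a b : ℕ) (t : ZMod a → ℤ) (d : ℕ) (r : ZMod a) : ℤ :=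
  ∑ i ∈ Finset.range d, t (r + i * b)

lemma sum_shift (a : ℕ) [NeZero a] (f : ZMod a → ℤ) (c : ZMod a) :
    ∑ r, f (r + c) = ∑ r, f r := Equiv.sum_comp (Equiv.addRight c) f

lemma sum_mul_unit (a b : ℕ) [NeZero a] (hab : Nat.Coprime a b) (f : ZMod a → ℤ) (r : ZMod a) :
    ∑ d ∈ Finset.range a, f (r + d * b) = ∑ r, f r := by
  rw [← sum_shift a f r]
  have hu : IsUnit (b : ZMod a) := (ZMod.isUnit_iff_coprime b a).2 hab.symm
  rw [← Equiv.sum_comp (hu.unit.mulRight) (fun x => f (x + r))]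
  rw [← sum_zmod_val a (fun d => f (r + d * b))]
  refine Finset.sum_congr rfl fun d _ => ?_
  simp [add_comm]

variable {a b : ℕ} [NeZero a] {m t : ZMod a → ℤ}

lemma sum_t (hm : ∀ r, m (r + b) = m r + b - a * t r) : ∑ r, t r = b := by
  have ha : (a : ℤ) ≠ 0 := by exact_mod_cast NeZero.ne a
  have h1 := sum_shift a m b
  simp only [hm, Finset.sum_sub_distrib, Finset.sum_add_distrib, ← Finset.mul_sum] at h1
  simp [ZMod.card] at h1
  have : (a : ℤ) * (∑ r, t r) = a * b := by linarith
  exact mul_left_cancel₀ ha this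

lemma m_tau (hm : ∀ r, m (r + b) = m r + b - a * t r) (d : ℕ) (r : ZMod a) :
    m (r + d * b) = m r + d * b - a * tau a b t d r := by
  induction d with
  | zero => simp [tau]
  | succ d ih =>
    have h1 : r + ((d + 1 : ℕ) : ZMod a) * b = (r + d * b) + b := by push_cast; ring
    rw [h1, hm, ih]
    unfold tau
    rw [Finset.sum_range_succ]
    push_cast
    ring

lemma tau_nonneg (ht : ∀ r, 0 ≤ t r) (d : ℕ) (r : ZMod a) : 0 ≤ tau a b t d r :=
  Finset.sum_nonneg fun _ _ => ht _

lemma tau_le (hab : Nat.Coprime a b) (ht : ∀ r, 0 ≤ t r)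
    (hm : ∀ r, m (r + b) = m r + b - a * t r) {d : ℕ} (hd : d ≤ a) (r : ZMod a) :
    tau a b t d r ≤ b := by
  rw [← sum_t hm, ← sum_mul_unit a b hab t r]
  apply Finset.sum_le_sum_of_subset_of_nonneg
  · intro x hx
    simp only [Finset.mem_range] at hx ⊢
    omega
  · intro _ _ _; exact ht _

lemma sum_tau (hm : ∀ r, m (r + b) = m r + b - a * t r) (d : ℕ) :
    ∑ r, tau a b t d r = d * b := by
  unfold tau
  rw [Finset.sum_comm]
  simp only [sum_shift a t, sum_t hm]
  simp

lemma sum_diff_sq (hm : ∀ r, m (r + b) = m r + b - a * t r) (d : ℕ) :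
    ∑ r, (m (r + d * b) - m r) ^ 2 = (a : ℤ) ^ 2 * b * (d * b) - a * (d * b) ^ 2
      - a ^ 2 * ∑ r, tau a b t d r * (b - tau a b t d r) := by
  have h1 : ∀ r, (m (r + d * b) - m r) ^ 2 = ((d : ℤ) * b) ^ 2
      - (2 * a * (d * b)) * tau a b t d r + (a ^ 2 * b) * tau a b t d r
      - a ^ 2 * (tau a b t d r * (b - tau a b t d r)) := by
    intro r
    rw [m_tau hm]
    ring
  simp only [h1, Finset.sum_sub_distrib, Finset.sum_add_distrib, ← Finset.mul_sum, sum_tau hm]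
  simp [ZMod.card]
  ring

lemma main_identity (hab : Nat.Coprime a b) (hm : ∀ r, m (r + b) = m r + b - a * t r) :
    2 * a * ∑ r, m r ^ 2 - 2 * (∑ r, m r) ^ 2 =
      ∑ d ∈ Finset.range a, ((a : ℤ) ^ 2 * b * (d * b) - a * (d * b) ^ 2)
      - a ^ 2 * ∑ d ∈ Finset.range a, ∑ r, tau a b t d r * (b - tau a b t d r) := by
  have hR : ∑ d ∈ Finset.range a, ((a : ℤ) ^ 2 * b * (d * b) - a * (d * b) ^ 2)
      - a ^ 2 * ∑ d ∈ Finset.range a, ∑ r, tau a b t d r * (b - tau a b t d r) =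
      ∑ d ∈ Finset.range a, ∑ r, (m (r + d * b) - m r) ^ 2 := by
    rw [Finset.mul_sum, ← Finset.sum_sub_distrib]
    exact Finset.sum_congr rfl fun d _ => (sum_diff_sq hm d).symm
  rw [hR, Finset.sum_comm]
  have h1 : ∀ r, ∑ d ∈ Finset.range a, (m (r + d * b) - m r) ^ 2 =
      ∑ x, (m x - m r) ^ 2 := by
    intro r
    exact sum_mul_unit a b hab (fun x => (m x - m r) ^ 2) r
  simp only [h1]
  have h2 : ∀ r, ∑ x, (m x - m r) ^ 2 = ∑ x, m x ^ 2 - 2 * m r * ∑ x, m x + a * m r ^ 2 := by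
    intro r
    have : ∀ x, (m x - m r) ^ 2 = m x ^ 2 - 2 * m r * m x + m r ^ 2 := fun x => by ring
    simp only [this, Finset.sum_add_distrib, Finset.sum_sub_distrib, ← Finset.mul_sum]
    simp [ZMod.card]
  simp only [h2, Finset.sum_add_distrib, Finset.sum_sub_distrib, ← Finset.mul_sum, ← Finset.sum_mul]
  simp [ZMod.card]
  ring

end Quad

section Extremal

/-- `X` is the complement of `c + ⟨a, b⟩`. -/
def IsY (a b c : ℕ) (X : Finset ℕ) : Prop := ∀ x, x ∉ X ↔ ∃ i j : ℕ, x = c + i * a + j * b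

lemma exists_Y (a b c : ℕ) (ha : 0 < a) (hb : 0 < b) (hab : Nat.Coprime a b) :
    ∃ X : Finset ℕ, IsY a b c X := by
  classical
  refine ⟨(Finset.range (c + a * b)).filter (fun x => ¬ ∃ i j : ℕ, x = c + i * a + j * b), ?_⟩
  intro x
  simp only [Finset.mem_filter, Finset.mem_range, not_and, not_not]
  constructor
  · intro h
    by_cases hx : x < c + a * b
    · exact h hx
    · obtain ⟨i, j, hij⟩ := Nat.exists_add_mul_eq_of_gcd_dvd_of_mul_pred_le a b (x - c)
        (by rw [hab]; exact one_dvd _)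
        (by
          have : a.pred * b.pred ≤ a * b := Nat.mul_le_mul (Nat.pred_le a) (Nat.pred_le b)
          omega)
      exact ⟨i, j, by omega⟩
  · intro h _
    exact h

lemma IsY.closed_left {a b c : ℕ} {X : Finset ℕ} (h : IsY a b c X) : ClosedSub a X := by
  intro x hx hax
  by_contra hc
  obtain ⟨i, j, hij⟩ := (h _).1 hc
  refine (h x).2 ⟨i + 1, j, ?_⟩ hx
  rw [add_mul]
  omega

lemma IsY.closed_right {a b c : ℕ} {X : Finset ℕ} (h : IsY a b c X) : ClosedSub b X := by
  intro x hx hax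
  by_contra hc
  obtain ⟨i, j, hij⟩ := (h _).1 hc
  refine (h x).2 ⟨i, j + 1, ?_⟩ hx
  rw [add_mul]
  omega

lemma IsY.le_card {a b c : ℕ} {X : Finset ℕ} (h : IsY a b c X) : c ≤ X.card := by
  have : Finset.range c ⊆ X := by
    intro x hx
    rw [Finset.mem_range] at hx
    by_contra hc
    obtain ⟨i, j, hij⟩ := (h _).1 hc
    omega
  simpa using Finset.card_le_card this

/-- natural number version of the gap -/
lemma exists_gap_nat (a : ℕ) [NeZero a] {X : Finset ℕ} (h : ClosedSub a X) (r : ZMod a) :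
    ∃ y : ℕ, gap a X r = y ∧ (y : ZMod a) = r ∧ y ∉ X := by
  obtain ⟨y, hy⟩ := Int.eq_ofNat_of_zero_le (gap_nonneg a X r)
  have hyr : (y : ZMod a) = r := by
    have := gap_cast a X r
    rw [hy] at this
    simpa using this
  refine ⟨y, hy, hyr, ?_⟩
  rw [mem_iff_lt_gap a h, hyr, hy]; simp

lemma IsY.t_zero {a b c : ℕ} [NeZero a] {X : Finset ℕ} (h : IsY a b c X) {t : ZMod a → ℤ}
    (ht : ∀ r, 0 ≤ t r) (hm : ∀ r, gap a X (r + b) = gap a X r + b - a * t r)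
    (r : ZMod a) (hr : r + b ≠ c) : t r = 0 := by
  have ha : (0 : ℤ) < a := by exact_mod_cast Nat.pos_of_ne_zero (NeZero.ne a)
  obtain ⟨y, hy, hyr, hyX⟩ := exists_gap_nat a h.closed_left (r + b)
  obtain ⟨i, j, hij⟩ := (h y).1 hyX
  rcases j with _ | j
  · exfalso
    apply hr
    rw [← hyr, hij]
    simp
  · have h1 : c + i * a + j * b ∉ X := (h _).2 ⟨i, j, rfl⟩
    have h2 : ((c + i * a + j * b : ℕ) : ZMod a) = r := by
      have : (y : ZMod a) = ((c + i * a + j * b : ℕ) : ZMod a) + b := by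
        rw [hij]; push_cast; ring
      rw [hyr] at this
      exact (add_right_cancel this).symm
    rw [mem_iff_lt_gap a h.closed_left, h2, not_lt] at h1
    have h3 := hm r
    rw [hy, hij] at h3
    push_cast at h3 h1
    have h4 : (a : ℤ) * t r ≤ 0 := by linarith
    have := ht r
    nlinarith

lemma tau_zero_or {a b : ℕ} [NeZero a] {m t : ZMod a → ℤ} (hab : Nat.Coprime a b)
    (ht : ∀ r, 0 ≤ t r)
    (hm : ∀ r, m (r + b) = m r + b - a * t r) (r0 : ZMod a) (h0 : ∀ r, r ≠ r0 → t r = 0)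
    {d : ℕ} (hd : d ≤ a) (r : ZMod a) :
    tau a b t d r * (b - tau a b t d r) = 0 := by
  have htb : t r0 = b := by
    rw [← sum_t hm]
    exact (Finset.sum_eq_single r0 (fun r _ hr => h0 r hr) (by simp)).symm
  have hle := tau_le hab ht hm hd r
  by_cases hex : ∃ i ∈ Finset.range d, r + (i : ZMod a) * b = r0
  · obtain ⟨i, hi, hir⟩ := hex
    have : t (r + (i : ZMod a) * b) ≤ tau a b t d r :=
      Finset.single_le_sum (f := fun i : ℕ => t (r + (i : ZMod a) * b)) (fun _ _ => ht _) hi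
    rw [hir, htb] at this
    have : tau a b t d r = b := le_antisymm hle this
    rw [this]; ring
  · have : tau a b t d r = 0 := by
      apply Finset.sum_eq_zero
      intro i hi
      apply h0
      intro hc
      exact hex ⟨i, hi, hc⟩
    rw [this]; ring

lemma extremal {a b c : ℕ} (ha : 1 < a) (hb : 0 < b) (hab : Nat.Coprime a b)
    {X Y : Finset ℕ} (hXa : ClosedSub a X) (hXb : ClosedSub b X) (hY : IsY a b c Y)
    (hcard : X.card = Y.card) (hsum : ∑ x ∈ Y, x ≤ ∑ x ∈ X, x) :
    ∃ c', IsY a b c' X := by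
  have : NeZero a := ⟨by omega⟩
  have ha0 : (0 : ℤ) < a := by exact_mod_cast (by omega : 0 < a)
  obtain ⟨t, ht, hm⟩ := exists_t a b hXa hXb
  obtain ⟨u, hu, hn⟩ := exists_t a b hY.closed_left hY.closed_right
  have hu0 : ∀ r, r ≠ (c : ZMod a) - b → u r = 0 := by
    intro r hr
    apply hY.t_zero hu hn
    intro hc
    apply hr
    rw [← hc]; ring
  have idX := main_identity hab hm
  have idY := main_identity hab hn
  have hYz : ∑ d ∈ Finset.range a, ∑ r, tau a b u d r * (b - tau a b u d r) = 0 :=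
    Finset.sum_eq_zero fun d hd => Finset.sum_eq_zero fun r _ =>
      tau_zero_or hab hu hn _ hu0 (Finset.mem_range.1 hd).le r
  rw [hYz] at idY
  rw [sum_gap a hXa, sum_gap_sq a hXa, hcard] at idX
  rw [sum_gap a hY.closed_left, sum_gap_sq a hY.closed_left] at idY
  have hsum' : ∑ x ∈ Y, (x : ℤ) ≤ ∑ x ∈ X, (x : ℤ) := by
    have h1 := (Nat.cast_le (α := ℤ)).2 hsum
    rwa [Nat.cast_sum, Nat.cast_sum] at h1
  have hnn : ∀ d ∈ Finset.range a, ∀ r ∈ Finset.univ,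
      0 ≤ tau a b t d r * (b - tau a b t d r) := by
    intro d hd r _
    have h1 := tau_nonneg (b := b) ht d r
    have h2 := tau_le hab ht hm (Finset.mem_range.1 hd).le r
    exact mul_nonneg h1 (by linarith)
  have hnn2 : ∀ d ∈ Finset.range a, 0 ≤ ∑ r, tau a b t d r * (b - tau a b t d r) :=
    fun d hd => Finset.sum_nonneg (hnn d hd)
  have hS : ∑ d ∈ Finset.range a, ∑ r, tau a b t d r * (b - tau a b t d r) = 0 := by
    apply le_antisymm _ (Finset.sum_nonneg hnn2)
    have h1 : (2 * (a : ℤ)) * (2 * a * ∑ x ∈ Y, (x : ℤ)) ≤ (2 * a) * (2 * a * ∑ x ∈ X, (x : ℤ)) := by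
      gcongr
    have h2 : (a : ℤ) ^ 2 * ∑ d ∈ Finset.range a, ∑ r, tau a b t d r * (b - tau a b t d r) ≤ 0 := by
      linarith
    have h3 : (0 : ℤ) < (a : ℤ) ^ 2 := by positivity
    by_contra hc
    push Not at hc
    have := mul_pos h3 hc
    linarith
  have hT : ∀ r, t r = 0 ∨ t r = b := by
    intro r
    have h1 := (Finset.sum_eq_zero_iff_of_nonneg hnn2).1 hS 1 (Finset.mem_range.2 ha)
    have h2 := (Finset.sum_eq_zero_iff_of_nonneg (hnn 1 (Finset.mem_range.2 ha))).1 h1 r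
      (Finset.mem_univ r)
    have h3 : tau a b t 1 r = t r := by simp [tau]
    rw [h3] at h2
    rcases mul_eq_zero.1 h2 with h | h
    · left; exact h
    · right; linarith
  have hst := sum_t hm
  have hb' : (0 : ℤ) < b := by exact_mod_cast hb
  obtain ⟨r0, hr0⟩ : ∃ r0, t r0 = b := by
    by_contra hc
    push Not at hc
    have : ∑ r, t r = 0 := Finset.sum_eq_zero fun r _ => (hT r).resolve_right (hc r)
    linarith
  have h0 : ∀ r, r ≠ r0 → t r = 0 := by
    intro r hr
    refine (hT r).resolve_right fun hc => ?_
    have h1 : ∑ x ∈ ({r, r0} : Finset (ZMod a)), t x ≤ ∑ x, t x :=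
      Finset.sum_le_sum_of_subset_of_nonneg (Finset.subset_univ _) (fun _ _ _ => ht _)
    rw [Finset.sum_pair hr] at h1
    linarith
  obtain ⟨c', hc', hc'r, hc'X⟩ := exists_gap_nat a hXa (r0 + b)
  refine ⟨c', fun x => ⟨?_, ?_⟩⟩
  · induction x using Nat.strong_induction_on with
    | _ x ih =>
      intro hx
      have hx' := hx
      rw [mem_iff_lt_gap a hXa, not_lt] at hx'
      obtain ⟨y, hy, hyr, hyX⟩ := exists_gap_nat a hXa (x : ZMod a)
      rw [hy] at hx'
      have hyx : y ≤ x := by exact_mod_cast hx'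
      rcases hyx.lt_or_eq with hlt | heq
      · have hmod : a ∣ x - y := (Nat.modEq_iff_dvd' hyx).1 ((ZMod.natCast_eq_natCast_iff _ _ _).1 hyr)
        have hax : a ≤ x - y := Nat.le_of_dvd (by omega) hmod
        have hxa : x - a ∉ X := by
          rw [mem_iff_lt_gap a hXa, not_lt, Nat.cast_sub (by omega : a ≤ x)]
          rw [ZMod.natCast_self, sub_zero, hy]
          exact_mod_cast (by omega : y ≤ x - a)
        obtain ⟨i, j, hij⟩ := ih (x - a) (by omega) hxa
        exact ⟨i + 1, j, by rw [add_mul]; omega⟩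
      · subst heq
        by_cases hr : (y : ZMod a) = r0 + b
        · refine ⟨0, 0, ?_⟩
          rw [hr, hc'] at hy
          have : c' = y := by exact_mod_cast hy
          omega
        · have h1 := hm ((y : ZMod a) - b)
          rw [h0 _ (by intro hc; apply hr; rw [← hc]; ring), sub_add_cancel, hy] at h1
          obtain ⟨z, hz, hzr, hzX⟩ := exists_gap_nat a hXa ((y : ZMod a) - b)
          rw [hz] at h1
          have h2 : y = z + b := by
            have : (y : ℤ) = z + b := by linarith
            exact_mod_cast this
          obtain ⟨i, j, hij⟩ := ih z (by omega) hzX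
          exact ⟨i, j + 1, by rw [add_mul]; omega⟩
  · rintro ⟨i, j, rfl⟩
    have hA : ∀ i, c' + i * a ∉ X := by
      intro i
      induction i with
      | zero => simpa using hc'X
      | succ i ih =>
        intro hc
        apply ih
        have := hXa _ hc (by rw [add_mul]; omega)
        convert this using 1
        rw [add_mul]; omega
    induction j with
    | zero => simpa using hA i
    | succ j ih =>
      intro hc
      apply ih
      have := hXb _ hc (by rw [add_mul]; omega)
      convert this using 1
      rw [add_mul]; omega

end Extremal

section Runners

lemma Y0_mem {s k : ℕ} (hs : s = 2 * k) (hk : 1 < k) {X : Finset ℕ}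
    (h : IsY (s - 1) (s + 1) 0 X) {r : ℕ} (hr : r < s) (q : ℕ) :
    r + s * q ∉ X ↔ (r ≤ q ∧ q % 2 = r % 2) ∨ (s - 1 - r ≤ q ∧ q % 2 ≠ r % 2) := by
  obtain ⟨u, rfl⟩ : ∃ u, s = u + 1 := ⟨s - 1, by omega⟩
  rw [h]
  simp only [Nat.add_sub_cancel]
  constructor
  · rintro ⟨i, j, hij⟩
    have hz : ((2 * k : ℕ) : ℤ) * ((q : ℤ) - i - j) = j - i - r := by
      rw [← hs]
      have : ((r + (u + 1) * q : ℕ) : ℤ) = ((0 + i * u + j * (u + 1 + 1) : ℕ) : ℤ) := by rw [hij]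
      push_cast at this ⊢
      linarith
    obtain ⟨z, hzd⟩ : ∃ z : ℤ, z = (q : ℤ) - i - j := ⟨_, rfl⟩
    rw [← hzd] at hz
    push_cast at hz
    have hpar : ∃ p : ℤ, (k : ℤ) * z = p := ⟨_, rfl⟩
    obtain ⟨p, hp⟩ := hpar
    have hz2 : 2 * p = j - i - r := by rw [← hp, ← hz]; ring
    rcases lt_trichotomy z 0 with hz0 | hz0 | hz0
    · -- z negative
      rcases Int.lt_or_le (-2) z with h1 | h1
      · have : z = -1 := by omega
        subst this
        right
        omega
      · have : p ≤ -2 * k := by nlinarith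
        have hw : p + (-z) * 1 ≤ - 2 * k + 2 := by nlinarith
        by_cases hpar : q % 2 = r % 2
        · left; omega
        · right; omega
    · subst hz0
      left
      omega
    · have : (k : ℤ) ≤ p := by nlinarith
      by_cases hpar : q % 2 = r % 2
      · left; omega
      · right; omega
  · rintro (⟨h1, h2⟩ | ⟨h1, h2⟩)
    · obtain ⟨p, hp⟩ : ∃ p, q = r + 2 * p := ⟨(q - r) / 2, by omega⟩
      refine ⟨p, r + p, ?_⟩
      rw [hp]; ring
    · obtain ⟨p, hp⟩ : ∃ p, q = (u - r) + 2 * p := ⟨(q - (u - r)) / 2, by omega⟩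
      obtain ⟨v, hv⟩ : ∃ v, u = r + v := ⟨u - r, by omega⟩
      refine ⟨v + 1 + p, p, ?_⟩
      rw [hp, hv, Nat.add_sub_cancel_left]; ring

lemma Y0_cnt {s k : ℕ} (hs : s = 2 * k) (hk : 1 < k) {X : Finset ℕ}
    (h : IsY (s - 1) (s + 1) 0 X) {r : ℕ} (hr : r < s) : cnt s X r = k - 1 := by
  have key := Y0_mem hs hk h hr
  have hs0 : 0 < s := by omega
  have hdiv : ∀ q, (r + s * q) / s = q := by
    intro q
    rw [Nat.add_mul_div_left _ _ hs0, Nat.div_eq_of_lt hr, zero_add]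
  have hmod : ∀ q, (r + s * q) % s = r := by
    intro q
    rw [Nat.add_mul_mod_self_left, Nat.mod_eq_of_lt hr]
  have hx : ∀ x, x % s = r → x = r + s * (x / s) := by
    intro x hx
    rw [← hx]; exact (Nat.mod_add_div x s).symm
  unfold cnt
  rw [← Finset.card_range (k - 1)]
  symm
  refine Finset.card_bij'
    (fun p _ => r + s * (if p < r / 2 then r - 2 - 2 * p else s - 1 - r - 2 - 2 * (p - r / 2)))
    (fun x _ => if (x / s) % 2 = r % 2 then (r - 2 - x / s) / 2
      else r / 2 + (s - 1 - r - 2 - x / s) / 2) ?_ ?_ ?_ ?_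
  · intro p hp
    rw [Finset.mem_range] at hp
    rw [Finset.mem_filter]
    refine ⟨?_, hmod _⟩
    by_contra hc
    rw [key] at hc
    split_ifs at hc <;> omega
  · intro x hxX
    rw [Finset.mem_filter] at hxX
    rw [Finset.mem_range]
    have h1 : ¬ (r + s * (x / s) ∉ X) := by
      rw [← hx x hxX.2]; simpa using hxX.1
    rw [key] at h1
    generalize x / s = q at *
    split_ifs <;> omega
  · intro p hp
    rw [Finset.mem_range] at hp
    simp only [hdiv]
    split_ifs <;> omega
  · intro x hxX
    rw [Finset.mem_filter] at hxX
    have h1 : ¬ (r + s * (x / s) ∉ X) := by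
      rw [← hx x hxX.2]; simpa using hxX.1
    rw [key] at h1
    conv_rhs => rw [hx x hxX.2]
    congr 2
    generalize x / s = q at *
    split_ifs <;> omega

lemma periodic_mod {s : ℕ} {f : ℕ → ℕ} (hf : ∀ x, f (x + s) = f x) (x : ℕ) : f (x % s) = f x := by
  have : Function.Periodic f s := hf
  exact this.map_mod_nat x

lemma sum_periodic {s : ℕ} (hs : 0 < s) {f : ℕ → ℕ} (hf : ∀ x, f (x + s) = f x) (X : Finset ℕ) :
    ∑ x ∈ X, f x = ∑ r ∈ Finset.range s, cnt s X r * f r := by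
  have hmaps : ∀ x ∈ X, x % s ∈ Finset.range s := fun x _ => Finset.mem_range.2 (Nat.mod_lt x hs)
  rw [← Finset.sum_fiberwise_of_maps_to hmaps]
  refine Finset.sum_congr rfl fun r _ => ?_
  rw [cnt, ← smul_eq_mul, ← Finset.sum_const]
  refine Finset.sum_congr rfl fun x hx => ?_
  rw [Finset.mem_filter] at hx
  rw [← hx.2, periodic_mod hf]

lemma sum_range_periodic {s : ℕ} {f : ℕ → ℕ} (hf : ∀ x, f (x + s) = f x) (n : ℕ) :
    ∑ x ∈ Finset.range (n * s), f x = n * ∑ r ∈ Finset.range s, f r := by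
  induction n with
  | zero => simp
  | succ n ih =>
    rw [add_mul, one_mul, Finset.sum_range_add, ih, add_mul, one_mul]
    congr 1
    refine Finset.sum_congr rfl fun x _ => ?_
    have : Function.Periodic f s := hf
    rw [add_comm]
    exact this.nat_mul n x

lemma Y0_sum {s k : ℕ} (hs : s = 2 * k) (hk : 1 < k) {X : Finset ℕ}
    (h : IsY (s - 1) (s + 1) 0 X) (f : ℕ → ℕ) (hf : ∀ x, f (x + s) = f x) :
    ∑ x ∈ X, f x = ∑ x ∈ Finset.range X.card, f x := by
  have hs0 : 0 < s := by omega
  have hgen : ∀ g : ℕ → ℕ, (∀ x, g (x + s) = g x) →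
      ∑ x ∈ X, g x = (k - 1) * ∑ r ∈ Finset.range s, g r := by
    intro g hg
    rw [sum_periodic hs0 hg, Finset.mul_sum]
    refine Finset.sum_congr rfl fun r hr => ?_
    rw [Y0_cnt hs hk h (Finset.mem_range.1 hr)]
  have hcard : X.card = (k - 1) * s := by
    have := hgen (fun _ => 1) (fun _ => rfl)
    simpa using this
  rw [hgen f hf, hcard, sum_range_periodic hf]

lemma Y_sum {s k c : ℕ} (hs : s = 2 * k) (hk : 1 < k) (hcop : Nat.Coprime (s - 1) (s + 1))
    {X : Finset ℕ}
    (h : IsY (s - 1) (s + 1) c X) (f : ℕ → ℕ) (hf : ∀ x, f (x + s) = f x) :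
    ∑ x ∈ X, f x = ∑ x ∈ Finset.range X.card, f x := by
  obtain ⟨X0, h0⟩ := exists_Y (s - 1) (s + 1) 0 (by omega) (by omega) hcop
  have hX : X = Finset.range c ∪ X0.image (fun x => c + x) := by
    ext x
    rw [Finset.mem_union, Finset.mem_range, Finset.mem_image]
    constructor
    · intro hx
      by_cases hxc : x < c
      · left; exact hxc
      · right
        refine ⟨x - c, ?_, by omega⟩
        by_contra hc
        obtain ⟨i, j, hij⟩ := (h0 _).1 hc
        exact (h x).2 ⟨i, j, by omega⟩ hx
    · rintro (hx | ⟨y, hy, rfl⟩)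
      · by_contra hc
        obtain ⟨i, j, hij⟩ := (h _).1 hc
        omega
      · by_contra hc
        obtain ⟨i, j, hij⟩ := (h _).1 hc
        exact (h0 y).2 ⟨i, j, by omega⟩ hy
  have hdisj : Disjoint (Finset.range c) (X0.image (fun x => c + x)) := by
    rw [Finset.disjoint_left]
    intro x hx hx2
    rw [Finset.mem_range] at hx
    obtain ⟨y, _, rfl⟩ := Finset.mem_image.1 hx2
    omega
  have hinj : Function.Injective (fun x => c + x) := fun x y h => by simpa using h
  have hcard : X.card = c + X0.card := by
    rw [hX, Finset.card_union_of_disjoint hdisj, Finset.card_range,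
      Finset.card_image_of_injective _ hinj]
  rw [hcard, Finset.sum_range_add, hX, Finset.sum_union hdisj,
    Finset.sum_image (fun x _ y _ h => hinj h)]
  congr 1
  exact Y0_sum hs hk h0 (fun x => f (c + x)) (fun x => by rw [← add_assoc]; exact hf _)

end Runners

namespace NPartition

lemma eq_emptyP {lam : NPartition} (h : ∀ i, lam.parts i = 0) : lam = emptyP := by
  obtain ⟨p, h1, h2⟩ := lam
  have : p = fun _ => 0 := funext h
  subst this
  rfl

lemma reduces_to_empty {s N : ℕ} (hs : 0 < s) : ∀ (n : ℕ) (lam : NPartition), lam.size = n →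
    lam.parts N = 0 →
    (∀ f : ℕ → ℕ, (∀ x, f (x + s) = f x) → ∑ x ∈ beads N lam, f x = ∑ x ∈ Finset.range N, f x) →
    Relation.ReflTransGen (RemoveHookStep s) lam emptyP := by
  intro n
  induction n using Nat.strong_induction_on with
  | _ n ih =>
    intro lam hn hN hsum
    by_cases hc : IsCore s lam
    · have hcl : ClosedSub s (beads N lam) := fun x hx hsx => core_closed hN hs hc hx hsx
      have hcr : ClosedSub s (Finset.range N) := by
        intro x hx _
        rw [Finset.mem_range] at hx ⊢
        omega
      have hcnt : ∀ r, cnt s (beads N lam) r = cnt s (Finset.range N) r := by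
        intro r
        unfold cnt
        rw [Finset.card_filter, Finset.card_filter]
        exact hsum (fun x => if x % s = r then 1 else 0) (fun x => by simp)
      have hX : beads N lam = Finset.range N := by
        ext x
        rw [mem_iff_lt_cnt hs hcl, mem_iff_lt_cnt hs hcr, hcnt]
      have h0 : lam.parts 0 = 0 := by
        rcases Nat.eq_zero_or_pos N with hz | hz
        · rw [hz] at hN; exact hN
        · have : lam.parts 0 + (N - 1 - 0) ∈ beads N lam := mem_beads.2 ⟨0, hz, rfl⟩
          rw [hX, Finset.mem_range] at this
          omega
      have : lam = emptyP := eq_emptyP fun i => by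
        have := lam.antitone (Nat.zero_le i)
        omega
      rw [this]
    · unfold IsCore at hc
      push Not at hc
      obtain ⟨i, j, hji, hh⟩ := hc
      obtain ⟨mu, hstep, hmuN, hsize, hf⟩ := exists_remove hN hji hh
      refine Relation.ReflTransGen.head hstep (ih mu.size (by omega) mu rfl hmuN ?_)
      intro f hper
      rw [hf f hper, hsum f hper]

end NPartition

/-- Let `s = 2k > 2` be even.  Then the `s`-core of `κ_{s-1,s+1}`, the
unique `(s-1, s+1)`-core partition of maximal size, is the empty partition. -/
theorem maximal_core_has_empty_s_core (s k : ℕ) (hs : s = 2 * k) (hs2 : 2 < s)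
    (κ : NPartition)
    (hκcore : NPartition.IsCore (s - 1) κ ∧ NPartition.IsCore (s + 1) κ)
    (hκmax : ∀ μ : NPartition,
      NPartition.IsCore (s - 1) μ → NPartition.IsCore (s + 1) μ → μ.size ≤ κ.size) :
    NPartition.HasSCore s κ NPartition.emptyP := by
  have hk : 1 < k := by omega
  have hcop : Nat.Coprime (s - 1) (s + 1) := by
    have h1 : s + 1 = (s - 1) + 2 := by omega
    rw [h1, Nat.coprime_self_add_right]
    exact (Nat.coprime_two_right).2 ⟨k - 1, by omega⟩
  obtain ⟨Y, hY⟩ := exists_Y (s - 1) (s + 1) κ.numParts (by omega) (by omega) hcop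
  obtain ⟨μ, hμN, hμY⟩ := NPartition.exists_of_finset Y
  have hκN : κ.parts Y.card = 0 := (κ.parts_eq_zero_iff' _).2 hY.le_card
  have hle := hκmax μ
    (NPartition.closed_core hμN (by rw [hμY]; exact hY.closed_left))
    (NPartition.closed_core hμN (by rw [hμY]; exact hY.closed_right))
  have hsum : ∑ x ∈ Y, x ≤ ∑ x ∈ NPartition.beads Y.card κ, x := by
    rw [NPartition.sum_beads_id hκN]
    conv_lhs => rw [← hμY]
    rw [NPartition.sum_beads_id hμN]
    omega
  obtain ⟨c, hc⟩ := extremal (a := s - 1) (b := s + 1) (by omega) (by omega) hcop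
    (X := NPartition.beads Y.card κ)
    (fun x hx h => NPartition.core_closed hκN (by omega) hκcore.1 hx h)
    (fun x hx h => NPartition.core_closed hκN (by omega) hκcore.2 hx h)
    hY (NPartition.card_beads _ _) hsum
  refine ⟨NPartition.reduces_to_empty (N := Y.card) (by omega) κ.size κ rfl hκN ?_, ?_⟩
  · intro f hf
    have := Y_sum hs hk hcop hc f hf
    rwa [NPartition.card_beads] at this
  · intro i j hj
    exact absurd hj (Nat.not_lt_zero j)
end

section
/- Let s = 2k > 2 be even. The s-quotient (λ_(0),…,λ_(s−1)) of κ_{s−1,s+1}, computed from its minimal bead-set (which is normalized with respect to s), satisfies λ_(i) = λ_(s−1−i) = τ_{k−1−i} for every 0 ≤ i ≤ k−1. -/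
namespace MCQ

theorem exists_gap (a : ℕ) [NeZero a] (X : Finset ℕ) (hX : ∀ x, x + a ∈ X → x ∈ X)
    (r : ZMod a) : ∃ n : ℕ, (n : ZMod a) = r ∧ ∀ x : ℕ, (x : ZMod a) = r → (x ∈ X ↔ x < n) := by
  classical
  have hapos : 0 < a := Nat.pos_of_ne_zero (NeZero.ne a)
  have hex : ∃ n : ℕ, (n : ZMod a) = r ∧ n ∉ X := by
    refine ⟨r.val + a * (X.sup id + 1), by simp, fun h => ?_⟩
    have := Finset.le_sup (f := id) h
    simp only [id] at this
    nlinarith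
  refine ⟨Nat.find hex, (Nat.find_spec hex).1, fun x hx => ?_⟩
  constructor
  · intro hxX
    by_contra hlt
    push Not at hlt
    have h1 := (Nat.find_spec hex).1
    have h2 := (Nat.find_spec hex).2
    set n := Nat.find hex
    have h3 : (n : ZMod a) = x := by rw [h1, hx]
    rw [ZMod.natCast_eq_natCast_iff] at h3
    obtain ⟨t, ht⟩ := (Nat.modEq_iff_dvd' hlt).1 h3
    have hx' : x = n + t * a := by rw [mul_comm]; omega
    have key : ∀ t, n + t * a ∈ X → n ∈ X := by
      intro t
      induction t with
      | zero => simp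
      | succ t ih =>
        intro h
        apply ih
        apply hX
        convert h using 1
        ring
    exact h2 (key t (hx' ▸ hxX))
  · intro hlt
    have := Nat.find_min hex hlt
    by_contra h
    exact this ⟨hx, h⟩

theorem tele (a : ℕ) [NeZero a] (X : Finset ℕ) (M : ZMod a → ℕ)
    (hM : ∀ r, (M r : ZMod a) = r) (hMX : ∀ x : ℕ, x ∈ X ↔ x < M (x : ZMod a))
    (g : ℤ → ℤ) :
    ∑ x ∈ X, (g (x + a) - g x) = ∑ r : ZMod a, (g (M r) - g r.val) := by
  classical
  have hapos : 0 < a := Nat.pos_of_ne_zero (NeZero.ne a)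
  rw [← Finset.sum_fiberwise (s := X) (g := fun x : ℕ => (x : ZMod a))]
  refine Finset.sum_congr rfl fun r _ => ?_
  have hr : r.val = M r % a := by
    conv_lhs => rw [← hM r]
    exact ZMod.val_natCast _ _
  obtain ⟨c, hc⟩ : ∃ c, M r = r.val + c * a := ⟨M r / a, by rw [hr, mul_comm]; exact (Nat.mod_add_div _ _).symm⟩
  have himg : X.filter (fun x : ℕ => (x : ZMod a) = r) =
      (Finset.range c).image (fun t => r.val + t * a) := by
    ext x
    simp only [Finset.mem_filter, Finset.mem_image, Finset.mem_range]
    constructor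
    · rintro ⟨h1, h2⟩
      rw [hMX, h2, hc] at h1
      have h3 : r.val = x % a := by
        rw [← h2]; exact ZMod.val_natCast _ _
      have h4 := Nat.mod_add_div x a
      refine ⟨x / a, ?_, by rw [h3, mul_comm]; exact h4⟩
      by_contra hcon
      push Not at hcon
      have := Nat.mul_le_mul_left a hcon
      nlinarith
    · rintro ⟨t, ht, rfl⟩
      have h2 : ((r.val + t * a : ℕ) : ZMod a) = r := by simp
      refine ⟨?_, h2⟩
      rw [hMX, h2, hc]
      have := Nat.mul_lt_mul_of_pos_right ht hapos
      omega
  rw [himg, Finset.sum_image]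
  · have := Finset.sum_range_sub (fun t : ℕ => g (r.val + t * a)) c
    rw [hc]
    push_cast
    simp only [Nat.cast_zero, zero_mul, add_zero] at this
    rw [← this]
    refine Finset.sum_congr rfl fun t _ => ?_
    push_cast
    ring_nf
  · intro t _ t' _ h
    simp only at h
    have : t * a = t' * a := by omega
    exact Nat.eq_of_mul_eq_mul_right hapos this

theorem sum_zmod (a : ℕ) [NeZero a] (f : ZMod a → ℤ) :
    ∑ j : ZMod a, f j = ∑ d ∈ Finset.range a, f (d : ZMod a) := by
  symm
  refine Finset.sum_nbij' (fun d => (d : ZMod a)) (fun j => j.val) ?_ ?_ ?_ ?_ ?_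
  · intros; simp
  · intro j _; simpa using ZMod.val_lt j
  · intro d hd; exact ZMod.val_cast_of_lt (Finset.mem_range.1 hd)
  · intro j _; simp
  · intros; rfl

theorem sum_id (a : ℕ) : 2 * ∑ d ∈ Finset.range a, (d : ℤ) = a * (a - 1) := by
  induction a with
  | zero => simp
  | succ n ih => rw [Finset.sum_range_succ, mul_add, ih]; push_cast; ring

theorem sum_sq (a : ℕ) : 6 * ∑ d ∈ Finset.range a, (d : ℤ) ^ 2 = a * (a - 1) * (2 * a - 1) := by
  induction a with
  | zero => simp
  | succ n ih => rw [Finset.sum_range_succ, mul_add, ih]; push_cast; ring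

/-- variance in terms of differences -/
theorem pair_sum (a : ℕ) [NeZero a] (y : ZMod a → ℤ) :
    ∑ d ∈ Finset.range a, ∑ i : ZMod a, (y (i + d) - y i) ^ 2
      = 2 * (a * ∑ i, y i ^ 2 - (∑ i, y i) ^ 2) := by
  rw [← sum_zmod a (fun d => ∑ i : ZMod a, (y (i + d) - y i) ^ 2), Finset.sum_comm]
  have h1 : ∀ i : ZMod a, ∑ d : ZMod a, (y (i + d) - y i) ^ 2 = ∑ d : ZMod a, (y d - y i) ^ 2 :=
    fun i => Equiv.sum_comp (Equiv.addLeft i) (fun d => (y d - y i) ^ 2)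
  simp_rw [h1]
  have h3 : ∀ i : ZMod a, ∑ d : ZMod a, (y d - y i) ^ 2 =
      ∑ d, y d ^ 2 - 2 * (∑ d, y d) * y i + a * y i ^ 2 := by
    intro i
    have h2 : ∀ d : ZMod a, (y d - y i) ^ 2 = y d ^ 2 - (2 * y i) * y d + y i ^ 2 := by
      intros; ring
    simp_rw [h2]
    rw [Finset.sum_add_distrib, Finset.sum_sub_distrib, ← Finset.mul_sum]
    simp [ZMod.card]
    ring
  simp_rw [h3]
  rw [Finset.sum_add_distrib, Finset.sum_sub_distrib, ← Finset.mul_sum, ← Finset.mul_sum]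
  simp [ZMod.card]
  ring

/-- The extremal inequality for the differences. -/
theorem extremal (a b : ℕ) [NeZero a] (ha : 2 ≤ a) (hb : 0 < b) (y z : ZMod a → ℤ)
    (hz : ∀ i, y (i + 1) = y i + b - a * z i) (hz0 : ∀ i, 0 ≤ z i)
    (hmax : (b : ℤ) ^ 2 * (a ^ 2 * (a - 1) * (a + 1)) ≤
      12 * (a * ∑ i, y i ^ 2 - (∑ i, y i) ^ 2)) :
    ∃ i0, ∀ d : ℕ, d < a → y (i0 + d) = y i0 + d * b := by
  have hapos : (0 : ℤ) < a := by exact_mod_cast (by omega : 0 < a)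
  have hzsum : ∑ i, z i = b := by
    have h1 : ∑ i : ZMod a, y (i + 1) = ∑ i, y i := Equiv.sum_comp (Equiv.addRight (1 : ZMod a)) y
    simp_rw [hz, Finset.sum_sub_distrib, Finset.sum_add_distrib, ← Finset.mul_sum] at h1
    simp [ZMod.card] at h1
    have : (a : ℤ) * ∑ i, z i = a * b := by linarith
    exact mul_left_cancel₀ hapos.ne' this
  let Z : ZMod a → ℕ → ℤ := fun i d => ∑ l ∈ Finset.range d, z (i + l)
  have hZ0 : ∀ i d, 0 ≤ Z i d := fun i d => Finset.sum_nonneg fun _ _ => hz0 _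
  have hZa : ∀ i, Z i a = b := by
    intro i
    rw [← hzsum, ← Equiv.sum_comp (Equiv.addLeft i) z]
    exact (sum_zmod a (fun l => z (i + l))).symm
  have hZb : ∀ i d, d ≤ a → Z i d ≤ b := by
    intro i d hd
    rw [← hZa i]
    exact Finset.sum_le_sum_of_subset_of_nonneg (Finset.range_mono hd) fun _ _ _ => hz0 _
  have hZs : ∀ d, ∑ i, Z i d = d * b := by
    intro d
    simp only [Z]
    rw [Finset.sum_comm]
    have : ∀ l : ℕ, ∑ i, z (i + l) = b := fun l => by
      rw [← hzsum]; exact Equiv.sum_comp (Equiv.addRight (l : ZMod a)) z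
    simp [this]
  have hyZ : ∀ i (d : ℕ), y (i + d) - y i = d * b - a * Z i d := by
    intro i d
    induction d with
    | zero => simp [Z]
    | succ d ih =>
      have : Z i (d + 1) = Z i d + z (i + d) := Finset.sum_range_succ _ _
      have h2 := hz (i + d)
      rw [this]
      push_cast
      rw [← add_assoc, h2]
      linarith
  have hT : ∀ d : ℕ, ∑ i : ZMod a, (y (i + d) - y i) ^ 2 =
      b ^ 2 * a * (d * a - d ^ 2) - a ^ 2 * ∑ i, Z i d * (b - Z i d) := by
    intro d
    simp_rw [hyZ]
    have h2 : ∀ i, ((d : ℤ) * b - a * Z i d) ^ 2 =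
        (d * b) ^ 2 + (a ^ 2 * b - 2 * d * b * a) * Z i d - a ^ 2 * (Z i d * (b - Z i d)) := by
      intros; ring
    simp_rw [h2, Finset.sum_sub_distrib, Finset.sum_add_distrib, ← Finset.mul_sum, hZs]
    simp [ZMod.card]
    ring
  have hP := pair_sum a y
  simp_rw [hT, Finset.sum_sub_distrib, ← Finset.mul_sum, Finset.sum_sub_distrib,
    ← Finset.sum_mul] at hP
  have e1 := sum_id a
  have e2 := sum_sq a
  have e3 : 6 * ((b:ℤ) ^ 2 * a * ((∑ d ∈ Finset.range a, (d : ℤ)) * a - ∑ d ∈ Finset.range a, (d : ℤ) ^ 2))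
      = b ^ 2 * (a ^ 2 * (a - 1) * (a + 1)) := by
    linear_combination 3 * (b:ℤ) ^ 2 * a ^ 2 * e1 - (b:ℤ) ^ 2 * a * e2
  have hnn : ∀ d ∈ Finset.range a, 0 ≤ ∑ i, Z i d * (b - Z i d) := fun d hd =>
    Finset.sum_nonneg fun i _ => mul_nonneg (hZ0 _ _)
      (sub_nonneg.2 (hZb _ _ (Finset.mem_range.1 hd).le))
  have hle : ∑ d ∈ Finset.range a, ∑ i, Z i d * (b - Z i d) ≤ 0 := by
    by_contra hcon
    push Not at hcon
    have := mul_pos (pow_pos hapos 2) hcon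
    linarith
  have h0 := (Finset.sum_eq_zero_iff_of_nonneg hnn).1 (le_antisymm hle (Finset.sum_nonneg hnn))
    1 (Finset.mem_range.2 (by omega))
  have hZ1 : ∀ i, Z i 1 = z i := by intro i; simp [Z]
  simp only [hZ1] at h0
  have hzb : ∀ i, z i ≤ b := fun i => hZ1 i ▸ hZb i 1 (by omega)
  have h1 : ∀ i, z i = 0 ∨ z i = b := by
    intro i
    have := (Finset.sum_eq_zero_iff_of_nonneg (fun i _ => mul_nonneg (hz0 i)
      (sub_nonneg.2 (hzb i)))).1 h0 i (Finset.mem_univ i)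
    rcases mul_eq_zero.1 this with h | h
    · exact Or.inl h
    · right; linarith
  obtain ⟨i1, hi1⟩ : ∃ i, z i ≠ 0 := by
    by_contra hcon
    push Not at hcon
    simp [hcon] at hzsum
    omega
  have hi1b : z i1 = b := (h1 i1).resolve_left hi1
  have hoth : ∀ i, i ≠ i1 → z i = 0 := by
    intro i hi
    have := Finset.add_sum_erase Finset.univ z (Finset.mem_univ i1)
    have h2 : ∑ x ∈ Finset.univ.erase i1, z x = 0 := by linarith
    exact (Finset.sum_eq_zero_iff_of_nonneg fun i _ => hz0 i).1 h2 i (by simp [hi])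
  refine ⟨i1 + 1, fun d => ?_⟩
  induction d with
  | zero => simp
  | succ d ih =>
    intro hd
    have hne : i1 + 1 + (d : ZMod a) ≠ i1 := by
      intro h
      have h3 : ((d + 1 : ℕ) : ZMod a) = 0 := by
        push_cast
        linear_combination h
      rw [ZMod.natCast_eq_zero_iff] at h3
      have := Nat.le_of_dvd (by omega) h3
      omega
    have h4 := hz (i1 + 1 + d)
    rw [hoth _ hne, ih (by omega)] at h4
    push_cast
    rw [← add_assoc, h4]
    ring

/-- `2 * (sum - choose)`-size of a bead set. -/
def dsize (X : Finset ℕ) : ℤ := 2 * ∑ x ∈ X, (x : ℤ) - X.card * (X.card - 1)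

theorem dsize_formula (a : ℕ) [NeZero a] (X : Finset ℕ) (M : ZMod a → ℕ)
    (hM : ∀ r, (M r : ZMod a) = r) (hMX : ∀ x : ℕ, x ∈ X ↔ x < M (x : ZMod a)) :
    2 * a * X.card = 2 * ∑ r, (M r : ℤ) - a * (a - 1) ∧
    12 * a ^ 2 * dsize X = 12 * (a * ∑ r, (M r : ℤ) ^ 2 - (∑ r, (M r : ℤ)) ^ 2)
      - a ^ 2 * (a - 1) * (a + 1) := by
  have t1 := tele a X M hM hMX (fun x => x)
  have t2 := tele a X M hM hMX (fun x => x ^ 2)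
  have v1 : ∑ r : ZMod a, (r.val : ℤ) = ∑ d ∈ Finset.range a, (d : ℤ) := by
    rw [sum_zmod]
    exact Finset.sum_congr rfl fun d hd => by rw [ZMod.val_cast_of_lt (Finset.mem_range.1 hd)]
  have v2 : ∑ r : ZMod a, (r.val : ℤ) ^ 2 = ∑ d ∈ Finset.range a, (d : ℤ) ^ 2 := by
    rw [sum_zmod]
    exact Finset.sum_congr rfl fun d hd => by rw [ZMod.val_cast_of_lt (Finset.mem_range.1 hd)]
  simp only [Finset.sum_sub_distrib, v1, v2] at t1 t2
  simp only [add_sq, Finset.sum_add_distrib, Finset.sum_const, nsmul_eq_mul] at t1 t2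
  rw [← Finset.sum_mul, ← Finset.mul_sum] at t2
  have e1 := sum_id a
  have e2 := sum_sq a
  have c1 : 2 * (a:ℤ) * X.card = 2 * ∑ r, (M r : ℤ) - a * (a - 1) := by
    linear_combination 2 * t1 - e1
  refine ⟨c1, ?_⟩
  unfold dsize
  have hA : 2 * ∑ r, (M r : ℤ) = 2 * (a:ℤ) * X.card + a * (a - 1) := by linarith
  have hA2 : 4 * (∑ r, (M r : ℤ)) ^ 2 = (2 * (a:ℤ) * X.card + a * (a - 1)) ^ 2 := by
    rw [← hA]; ring
  linear_combination 12 * a * t2 - 2 * a * e2 + 3 * hA2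

theorem mul_sum_comp (a b : ℕ) [NeZero a] (hab : Nat.Coprime b a) (f : ZMod a → ℤ) :
    ∑ j : ZMod a, f (j * b) = ∑ j, f j := by
  have h := Equiv.sum_comp (Units.mulRight (ZMod.unitOfCoprime b hab)) f
  simpa using h

theorem P_gap (a b : ℕ) (hab : Nat.Coprime b a) (d : ℕ) (hd : d < a) (x : ℕ)
    (hx : (x : ZMod a) = d * b) : (∃ u v : ℕ, x = u * a + v * b) ↔ d * b ≤ x := by
  have hx' : x ≡ d * b [MOD a] := by
    rw [← ZMod.natCast_eq_natCast_iff]; push_cast; exact hx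
  constructor
  · rintro ⟨u, v, rfl⟩
    have h1 : v * b ≡ d * b [MOD a] := by
      refine Nat.ModEq.trans ?_ hx'
      simp [Nat.ModEq]
    have h2 : v ≡ d [MOD a] := Nat.ModEq.cancel_right_of_coprime (by rw [Nat.gcd_comm]; exact hab) h1
    have h3 : d ≤ v := by
      have : v % a = d := by rw [h2, Nat.mod_eq_of_lt hd]
      rw [← this]; exact Nat.mod_le _ _
    have := Nat.mul_le_mul_right b h3
    omega
  · intro h
    obtain ⟨t, ht⟩ := (Nat.modEq_iff_dvd' h).1 hx'.symm
    exact ⟨t, d, by rw [mul_comm t]; omega⟩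

/-- Key theorem about bead sets. -/
theorem key (a b : ℕ) (ha : 2 ≤ a) (hb : 0 < b) (hab : Nat.Coprime b a) (P X : Finset ℕ)
    (hP : ∀ x, x ∈ P ↔ ¬ ∃ u v : ℕ, x = u * a + v * b)
    (h0 : 0 ∉ X) (hXa : ∀ x, x + a ∈ X → x ∈ X) (hXb : ∀ x, x + b ∈ X → x ∈ X)
    (hle : dsize P ≤ dsize X) :
    X = P ∧ 2 * (P.card : ℤ) = (a - 1) * (b - 1) := by
  have : NeZero a := ⟨by omega⟩
  have hapos : (0 : ℤ) < a := by exact_mod_cast (by omega : 0 < a)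
  have hPa : ∀ x, x + a ∈ P → x ∈ P := by
    intro x hx
    rw [hP] at hx ⊢
    rintro ⟨u, v, rfl⟩
    exact hx ⟨u + 1, v, by ring⟩
  choose MP hMP hMPX using exists_gap a P hPa
  choose M hM hMX using exists_gap a X hXa
  have fP := dsize_formula a P MP hMP (fun x => hMPX _ x rfl)
  have fX := dsize_formula a X M hM (fun x => hMX _ x rfl)
  have hyP : ∀ d : ℕ, d < a → MP (d * b) = d * b := by
    intro d hd
    have hc : ((d * b : ℕ) : ZMod a) = d * b := by push_cast; rfl
    apply le_antisymm
    · by_contra hcon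
      push Not at hcon
      have := (hMPX _ (d * b) hc).2 hcon
      rw [hP] at this
      exact this ((P_gap a b hab d hd _ hc).2 le_rfl)
    · rw [← P_gap a b hab d hd _ (hMP _)]
      by_contra hcon
      rw [← hP, hMPX _ _ (hMP _)] at hcon
      exact lt_irrefl _ hcon
  have sP1 : ∑ r, (MP r : ℤ) = ∑ d ∈ Finset.range a, (d : ℤ) * b := by
    rw [← mul_sum_comp a b hab (fun r => (MP r : ℤ)), sum_zmod]
    exact Finset.sum_congr rfl fun d hd => by rw [hyP d (Finset.mem_range.1 hd)]; push_cast; rfl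
  have sP2 : ∑ r, (MP r : ℤ) ^ 2 = ∑ d ∈ Finset.range a, (d : ℤ) ^ 2 * b ^ 2 := by
    rw [← mul_sum_comp a b hab (fun r => (MP r : ℤ) ^ 2), sum_zmod]
    exact Finset.sum_congr rfl fun d hd => by
      rw [hyP d (Finset.mem_range.1 hd)]; push_cast; ring
  rw [← Finset.sum_mul] at sP1 sP2
  have e1 := sum_id a
  have e2 := sum_sq a
  have hcard : 2 * (P.card : ℤ) = (a - 1) * (b - 1) := by
    have := fP.1
    rw [sP1] at this
    have h5 : (a : ℤ) * (2 * P.card) = a * ((a - 1) * (b - 1)) := by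
      linear_combination this + b * e1
    exact mul_left_cancel₀ hapos.ne' h5
  refine ⟨?_, hcard⟩
  -- the y-sequence of X
  have hdvd : ∀ i : ZMod a, ∃ z : ℤ, 0 ≤ z ∧ (M ((i + 1) * b) : ℤ) = M (i * b) + b - a * z := by
    intro i
    have hc : ((M (i * b) + b : ℕ) : ZMod a) = (i + 1) * b := by
      push_cast; rw [hM]; ring
    have hle : M ((i + 1) * b) ≤ M (i * b) + b := by
      by_contra hcon
      push Not at hcon
      have h3 := hXb _ ((hMX _ _ hc).2 hcon)
      rw [hMX _ _ (hM _)] at h3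
      exact lt_irrefl _ h3
    have h4 : M ((i + 1) * b) ≡ M (i * b) + b [MOD a] := by
      rw [← ZMod.natCast_eq_natCast_iff, hM, hc]
    obtain ⟨t, ht⟩ := (Nat.modEq_iff_dvd' hle).1 h4
    refine ⟨t, by positivity, ?_⟩
    have h5 : M (i * b) + b = M ((i + 1) * b) + a * t := by omega
    have h6 : (M (i * b) : ℤ) + b = M ((i + 1) * b) + a * t := by exact_mod_cast h5
    linarith
  choose z hz0 hz using hdvd
  have sX1 := mul_sum_comp a b hab (fun r => (M r : ℤ))
  have sX2 := mul_sum_comp a b hab (fun r => (M r : ℤ) ^ 2)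
  have hext := extremal a b ha hb (fun i => (M (i * b) : ℤ)) z hz hz0 (by
    rw [sX1, sX2]
    have h7 := fP.2
    have h8 := fX.2
    have h9 : 12 * (a:ℤ) ^ 2 * dsize P ≤ 12 * (a:ℤ) ^ 2 * dsize X :=
      mul_le_mul_of_nonneg_left hle (by positivity)
    have h10 : 12 * ((a:ℤ) * ∑ r, (MP r : ℤ) ^ 2 - (∑ r, (MP r : ℤ)) ^ 2)
        = (b : ℤ) ^ 2 * (a ^ 2 * (a - 1) * (a + 1)) := by
      rw [sP1, sP2]
      have e3 : 4 * (∑ d ∈ Finset.range a, (d : ℤ)) ^ 2 = (a * (a - 1)) ^ 2 := by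
        rw [← e1]; ring
      linear_combination 2 * a * b ^ 2 * e2 - 3 * b ^ 2 * e3
    linarith)
  obtain ⟨i0, hi0⟩ := hext
  have hM0 : M 0 = 0 := by
    by_contra hcon
    exact h0 ((hMX 0 0 (by simp)).2 (Nat.pos_of_ne_zero hcon))
  have hi00 : i0 = 0 := by
    have h1 := hi0 (-i0).val (ZMod.val_lt _)
    simp [hM0] at h1
    have h2 : (0 : ℤ) ≤ M (i0 * b) := by positivity
    have h3 : (0 : ℤ) ≤ ((-i0).val : ℤ) * b := by positivity
    have h4 : ((-i0).val : ℤ) * b = 0 := by simp only [ZMod.natCast_val] at *; linarith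
    have h5 : (-i0).val = 0 := by
      rcases mul_eq_zero.1 h4 with h | h
      · exact_mod_cast h
      · exfalso; have : b = 0 := by exact_mod_cast h
        omega
    rw [ZMod.val_eq_zero] at h5
    simpa using h5
  subst hi00
  have hMM : M = MP := by
    funext r
    have hs := (Units.mulRight (ZMod.unitOfCoprime b hab)).surjective r
    obtain ⟨j, rfl⟩ := hs
    have h1 := hi0 j.val (ZMod.val_lt _)
    have h2 := hyP j.val (ZMod.val_lt _)
    simp only [zero_add, zero_mul, hM0, Nat.cast_zero] at h1
    rw [ZMod.natCast_zmod_val] at h1 h2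
    simp only [Units.mulRight_apply, ZMod.coe_unitOfCoprime]
    rw [h2]
    exact_mod_cast h1
  ext x
  rw [hMX _ x rfl, hMPX _ x rfl, hMM]

end MCQ

namespace MCQ
open NPartition

theorem numParts_spec (lam : NPartition) (i : ℕ) : 0 < lam.parts i ↔ i < lam.numParts := by
  obtain ⟨N, hN⟩ := lam.eventually_zero
  have hmem : lam.numParts ∈ {N | lam.parts N = 0} := Nat.sInf_mem ⟨N, hN N le_rfl⟩
  constructor
  · intro h
    by_contra hcon
    push Not at hcon
    have := lam.antitone hcon
    simp only [Set.mem_ofPred_eq] at hmem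
    omega
  · intro h
    have := Nat.notMem_of_lt_sInf h
    simp only [Set.mem_ofPred_eq] at this
    omega

theorem numParts_eq (lam : NPartition) (n : ℕ) (h : ∀ i, 0 < lam.parts i ↔ i < n) :
    lam.numParts = n := by
  have h1 := fun i => (numParts_spec lam i).symm.trans (h i)
  have h2 := h1 n
  have h3 := h1 lam.numParts
  omega

theorem mem_minBeadSet (lam : NPartition) (x : ℕ) : x ∈ lam.minBeadSet ↔
    ∃ i < lam.numParts, lam.parts i + (lam.numParts - (i + 1)) = x := by
  simp [minBeadSet, beadSet]

theorem zero_notMem (lam : NPartition) : 0 ∉ lam.minBeadSet := by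
  rw [mem_minBeadSet]
  rintro ⟨i, hi, h⟩
  have := (numParts_spec lam i).2 hi
  omega

theorem conj_eq (lam : NPartition) (j c : ℕ) (hc : ∀ i, j < lam.parts i ↔ i < c) :
    lam.conj.parts j = c := by
  have : (Finset.range lam.numParts).filter (fun i => j < lam.parts i) = Finset.range c := by
    ext i
    simp only [Finset.mem_filter, Finset.mem_range, hc]
    refine ⟨fun h => h.2, fun h => ⟨?_, h⟩⟩
    rw [← numParts_spec]
    have := (hc i).2 h
    omega
  simp only [conj, this, Finset.card_range]

theorem conj_spec (lam : NPartition) (j i : ℕ) : j < lam.parts i ↔ i < lam.conj.parts j := by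
  classical
  obtain ⟨N, hN⟩ := lam.eventually_zero
  have hex : ∃ c, lam.parts c ≤ j := ⟨N, by rw [hN N le_rfl]; omega⟩
  have key : ∀ i, j < lam.parts i ↔ i < Nat.find hex := by
    intro i
    constructor
    · intro h
      by_contra hcon
      push Not at hcon
      have := lam.antitone hcon
      have := Nat.find_spec hex
      omega
    · intro h
      have := Nat.find_min hex h
      omega
  rw [conj_eq lam j _ key]
  exact key i

theorem core_closed (lam : NPartition) (a : ℕ) (ha : 0 < a) (h : IsCore a lam) (y : ℕ)
    (hy : y + a ∈ lam.minBeadSet) : y ∈ lam.minBeadSet := by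
  classical
  by_contra hcon
  rw [mem_minBeadSet] at hy hcon
  push Not at hcon
  obtain ⟨i, hi, hiy⟩ := hy
  set m := lam.numParts with hm
  have hex : ∃ q, m ≤ q ∨ lam.parts q + (m - (q + 1)) < y := ⟨m, Or.inl le_rfl⟩
  set q := Nat.find hex with hq
  have hqm : q ≤ m := Nat.find_min' hex (Or.inl le_rfl)
  have hbelow : ∀ i' < q, y < lam.parts i' + (m - (i' + 1)) := by
    intro i' hi'
    have h1 := Nat.find_min hex hi'
    have h2 := hcon i' (by omega)
    omega
  have hiq : i < q := by
    by_contra hge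
    push Not at hge
    have h1 := Nat.find_spec hex
    rw [← hq] at h1
    have := lam.antitone hge
    omega
  -- column index
  have hjpos : m - q ≤ y := by
    by_contra hlt
    push Not at hlt
    have h1 := Nat.find_spec hex
    rw [← hq] at h1
    have h2 : q < m := by omega
    have := (numParts_spec lam q).2 h2
    omega
  have hcol : ∀ i', y - (m - q) < lam.parts i' ↔ i' < q := by
    intro i'
    constructor
    · intro h1
      by_contra hge
      push Not at hge
      have h2 := Nat.find_spec hex
      rw [← hq] at h2
      have := lam.antitone hge
      rcases h2 with h2 | h2
      · have := (numParts_spec lam i').1 (by omega)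
        omega
      · by_cases hqm' : q < m
        · omega
        · have := (numParts_spec lam i').1 (by omega)
          omega
    · intro h1
      have h2 := hbelow (q - 1) (by omega)
      have h3 : lam.parts (q - 1) ≤ lam.parts i' := lam.antitone (by omega)
      omega
  have hconj := conj_eq lam _ _ hcol
  have hlt := (hcol i).2 hiq
  apply h i (y - (m - q)) hlt
  unfold hookLength
  rw [hconj]
  omega

theorem closed_core (lam : NPartition) (a : ℕ) (h : ∀ y, y + a ∈ lam.minBeadSet → y ∈ lam.minBeadSet) :
    IsCore a lam := by
  intro i j hij hhook
  set m := lam.numParts with hm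
  set c := lam.conj.parts j with hc
  have hspec := conj_spec lam j
  rw [← hc] at hspec
  have hic := (hspec i).1 hij
  have hcm : c ≤ m := by
    by_contra hlt
    push Not at hlt
    have h1 := (hspec m).2 hlt
    have := (numParts_spec lam m).1 (by omega)
    omega
  unfold hookLength at hhook
  rw [← hc] at hhook
  have hy := h (j + (m - c)) (by
    rw [mem_minBeadSet]
    refine ⟨i, by omega, ?_⟩
    rw [← hm]
    omega)
  rw [mem_minBeadSet] at hy
  obtain ⟨i', hi', hy⟩ := hy
  rw [← hm] at hi' hy
  have := hspec i'
  by_cases hlt : i' < c <;> simp only [hlt, iff_true, iff_false] at this <;> omega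

theorem bead_inj (lam : NPartition) : ∀ i < lam.numParts, ∀ j < lam.numParts,
    lam.parts i + (lam.numParts - (i + 1)) = lam.parts j + (lam.numParts - (j + 1)) → i = j := by
  intro i hi j hj h
  rcases lt_trichotomy i j with h1 | h1 | h1
  · have := lam.antitone h1.le
    omega
  · exact h1
  · have := lam.antitone h1.le
    omega

theorem size_dsize (lam : NPartition) : (2 * lam.size : ℤ) = dsize lam.minBeadSet := by
  have hX : lam.minBeadSet = (Finset.range lam.numParts).image
      (fun i => lam.parts i + (lam.numParts - (i + 1))) := by
    ext x; rw [mem_minBeadSet]; simp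
  have hinj : Set.InjOn (fun i => lam.parts i + (lam.numParts - (i + 1)))
      (Finset.range lam.numParts : Set ℕ) := by
    intro i hi j hj h
    exact bead_inj lam i (by simpa using hi) j (by simpa using hj) h
  have hsz : lam.size = ∑ i ∈ Finset.range lam.numParts, lam.parts i := by
    unfold size
    apply finsum_eq_sum_of_support_subset
    intro i hi
    simp only [Function.mem_support] at hi
    simp only [Finset.coe_range, Set.mem_Iio]
    rw [← numParts_spec]
    omega
  unfold dsize
  rw [hX, Finset.sum_image hinj, Finset.card_image_of_injOn hinj, Finset.card_range, hsz]
  push_cast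
  rw [Finset.sum_add_distrib]
  have h1 : ∑ i ∈ Finset.range lam.numParts, ((lam.numParts - (i + 1) : ℕ) : ℤ)
      = ∑ i ∈ Finset.range lam.numParts, (i : ℤ) := by
    rw [← Finset.sum_range_reflect (fun i : ℕ => (i : ℤ))]
    refine Finset.sum_congr rfl fun i _ => ?_
    congr 1
    omega
  have := sum_id lam.numParts
  rw [h1]
  linarith

theorem exists_partition (X : Finset ℕ) (h0 : 0 ∉ X) : ∃ mu : NPartition, mu.minBeadSet = X := by
  classical
  set n := X.card with hn
  let e := X.orderEmbOfFin hn.symm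
  let f : ℕ → ℕ := fun i => if h : i < n then e ⟨i, h⟩ else 0
  have hf : ∀ i < n, f i ∈ X := by
    intro i hi
    simp only [f, hi, dif_pos]
    exact X.orderEmbOfFin_mem hn.symm _
  have hfs : ∀ i j, i < j → j < n → f i < f j := by
    intro i j hij hj
    simp only [f, hj, hij.trans hj, dif_pos]
    exact e.strictMono (by simpa using hij)
  have hfsurj : ∀ x ∈ X, ∃ i < n, f i = x := by
    intro x hx
    have : x ∈ Set.range e := by
      rw [Finset.range_orderEmbOfFin]; exact hx
    obtain ⟨i, rfl⟩ := this
    exact ⟨i, i.2, by simp [f]⟩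
  have hge : ∀ i < n, i + 1 ≤ f i := by
    intro i
    induction i with
    | zero =>
      intro hi
      have := hf 0 hi
      by_contra hcon
      have h1 : f 0 = 0 := by omega
      rw [h1] at this
      exact h0 this
    | succ i ih =>
      intro hi
      have := ih (by omega)
      have := hfs i (i + 1) (by omega) hi
      omega
  have hmono : ∀ i j, i ≤ j → j < n → f i + (j - i) ≤ f j := by
    intro i j hij
    induction j, hij using Nat.le_induction with
    | base => intro _; omega
    | succ j hij ih =>
      intro hj
      have := ih (by omega)
      have := hfs j (j + 1) (by omega) hj
      omega
  let mu : NPartition := ⟨fun i => if i < n then f (n - 1 - i) - (n - 1 - i) else 0, by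
    intro i j hij
    split_ifs with h1 h2
    · have := hmono (n - 1 - j) (n - 1 - i) (by omega) (by omega)
      omega
    · omega
    · omega
    · omega, ⟨n, fun i hi => by simp [not_lt.2 hi]⟩⟩
  have hmu : ∀ i, mu.parts i = if i < n then f (n - 1 - i) - (n - 1 - i) else 0 := fun _ => rfl
  have hnp : mu.numParts = n := by
    apply numParts_eq
    intro i
    rw [hmu]
    split_ifs with h
    · have := hge (n - 1 - i) (by omega)
      simp only [h, iff_true]
      omega
    · simp [h]
  refine ⟨mu, ?_⟩
  ext x
  rw [mem_minBeadSet, hnp]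
  constructor
  · rintro ⟨i, hi, rfl⟩
    have h1 := hge (n - 1 - i) (by omega)
    rw [hmu, if_pos hi]
    have h2 : f (n - 1 - i) - (n - 1 - i) + (n - (i + 1)) = f (n - 1 - i) := by omega
    rw [h2]
    exact hf _ (by omega)
  · intro hx
    obtain ⟨i, hi, rfl⟩ := hfsurj x hx
    have h1 := hge i hi
    refine ⟨n - 1 - i, by omega, ?_⟩
    rw [hmu, if_pos (by omega)]
    have h2 : n - 1 - (n - 1 - i) = i := by omega
    rw [h2]
    omega

/-- membership in the numerical semigroup generated by `s-1`, `s+1`, with `s = 2k`. -/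
theorem semigroup_mem (k i j : ℕ) (hk : 1 < k) (hi : i < 2 * k) :
    (∃ u v : ℕ, i + j * (2 * k) = u * (2 * k - 1) + v * (2 * k + 1)) ↔
      ((i ≤ j ∧ j % 2 = i % 2) ∨ (2 * k - i ≤ j + 1 ∧ (j + 1) % 2 = i % 2)) := by
  obtain ⟨p, hp⟩ : ∃ p, 2 * k = p + 1 := ⟨2 * k - 1, by omega⟩
  constructor
  · rintro ⟨u, v, h⟩
    have e : 2 * k - 1 = p := by omega
    rw [e, hp] at h
    -- i + j s + u = (u+v) s + v
    have h1 : i + j * (p + 1) + u = (u + v) * (p + 1) + v := by rw [h]; ring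
    rcases lt_trichotomy (u + v) j with hlt | heq | hgt
    · -- then v large
      obtain ⟨t, rfl⟩ : ∃ t, j = u + v + 1 + t := ⟨j - (u + v + 1), by omega⟩
      have h2 : i + (t + 1) * (p + 1) + u = v := by nlinarith
      have h3 : p + 1 ≤ (t + 1) * (p + 1) := Nat.le_mul_of_pos_left _ (by omega)
      have h4 : ((t + 1) * (p + 1)) % 2 = 0 := by
        rw [Nat.mul_mod]; have : (p + 1) % 2 = 0 := by omega
        simp [this]
      by_cases hpar : (u + v + 1 + t) % 2 = i % 2
      · left; exact ⟨by omega, hpar⟩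
      · right; exact ⟨by omega, by omega⟩
    · left
      subst heq
      have h2 : i + u = v := by omega
      omega
    · obtain ⟨t, ht⟩ : ∃ t, u + v = j + 1 + t := ⟨u + v - (j + 1), by omega⟩
      rw [ht] at h1
      have h2 : i + u = (t + 1) * (p + 1) + v := by nlinarith
      rcases Nat.eq_zero_or_pos t with rfl | htpos
      · right; omega
      · have h3 : (t + 1) * (p + 1) = p + 1 + t * p + t := by ring
        have h5 : t * 3 ≤ t * p := Nat.mul_le_mul_left _ (by omega)
        have h6 : p ≤ t * p := Nat.le_mul_of_pos_left _ htpos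
        have h4 : ((t + 1) * (p + 1)) % 2 = 0 := by
          rw [Nat.mul_mod]; have : (p + 1) % 2 = 0 := by omega
          simp [this]
        by_cases hpar : j % 2 = i % 2
        · left; refine ⟨?_, hpar⟩; omega
        · right; refine ⟨?_, by omega⟩; omega
  · rintro (⟨h1, h2⟩ | ⟨h1, h2⟩)
    · refine ⟨(j - i) / 2, (j + i) / 2, ?_⟩
      have e : 2 * k - 1 = p := by omega
      rw [e, hp]
      obtain ⟨w, rfl⟩ : ∃ w, j = i + 2 * w := ⟨(j - i) / 2, by omega⟩
      have e1 : (i + 2 * w - i) / 2 = w := by omega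
      have e2 : (i + 2 * w + i) / 2 = i + w := by omega
      rw [e1, e2]; ring
    · have e : 2 * k - 1 = p := by omega
      rw [e, hp]
      obtain ⟨q, hq⟩ : ∃ q, p + 1 = i + q := ⟨p + 1 - i, by omega⟩
      obtain ⟨w, hw⟩ : ∃ w, j + 1 = q + 2 * w := ⟨(j + 1 - q) / 2, by omega⟩
      refine ⟨q + w, w, ?_⟩
      have h3 : (j + 1) * (p + 1) = (q + 2 * w) * (p + 1) := by rw [hw]
      nlinarith

theorem staircase_bead (l c x : ℕ) : x ∈ (staircase l).beadSet c ↔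
    x < c ∨ (x < c + 2 * l ∧ (x + 1) % 2 = c % 2) := by
  have hn : (staircase l).numParts = l := by
    apply numParts_eq
    intro i
    simp only [staircase]
    omega
  simp only [beadSet, hn, Finset.mem_union, Finset.mem_range, Finset.mem_image]
  have hp : ∀ i, (staircase l).parts i = l - i := fun _ => rfl
  simp only [hp]
  constructor
  · rintro (h | ⟨i, hi, rfl⟩)
    · exact Or.inl h
    · right; omega
  · rintro (h | ⟨h1, h2⟩)
    · exact Or.inl h
    · by_cases hx : x < c
      · exact Or.inl hx
      · right
        exact ⟨l - 1 - (x - c) / 2, by omega, by omega⟩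

theorem mem_runner (s i : ℕ) (hs : 0 < s) (X : Finset ℕ) (j : ℕ) :
    j ∈ runner s i X ↔ i + j * s ∈ X := by
  simp only [runner, Finset.mem_filter, Finset.mem_range, and_iff_right_iff_imp]
  intro h
  have := Finset.le_sup (f := id) h
  simp only [id] at this
  have := Nat.le_mul_of_pos_right j hs
  omega

end MCQ

/-- Let `s = 2k > 2` be even.  The `s`-quotient of `κ_{s-1,s+1}`, computed
from its minimal bead-set (which is normalized with respect to `s`), satisfies
`λ_(i) = λ_(s-1-i) = τ_{k-1-i}` for every `0 ≤ i ≤ k-1`. -/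
theorem maximal_core_quotient_staircases (s k : ℕ) (hs : s = 2 * k) (hs2 : 2 < s)
    (κ : NPartition)
    (hκcore : NPartition.IsCore (s - 1) κ ∧ NPartition.IsCore (s + 1) κ)
    (hκmax : ∀ μ : NPartition,
      NPartition.IsCore (s - 1) μ → NPartition.IsCore (s + 1) μ → μ.size ≤ κ.size) :
    NPartition.IsNormalizedBeadSet s κ κ.minBeadSet ∧
    ∀ i : ℕ, i ≤ k - 1 →
      (staircase (k - 1 - i)).IsBeadSet (runner s i κ.minBeadSet) ∧
      (staircase (k - 1 - i)).IsBeadSet (runner s (s - 1 - i) κ.minBeadSet) := by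
  classical
  subst hs
  -- the set of gaps of the numerical semigroup
  let P : Finset ℕ := (Finset.range (2 * k * (2 * k))).filter
    (fun x => ¬ ∃ u v : ℕ, x = u * (2 * k - 1) + v * (2 * k + 1))
  have hP : ∀ x, x ∈ P ↔ ¬ ∃ u v : ℕ, x = u * (2 * k - 1) + v * (2 * k + 1) := by
    intro x
    simp only [P, Finset.mem_filter, Finset.mem_range, and_iff_right_iff_imp]
    intro h
    by_contra hcon
    push Not at hcon
    apply h
    have hdm := Nat.mod_add_div x (2 * k)
    have hlt := Nat.mod_lt x (show 2 * k > 0 by omega)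
    have hj : 2 * k ≤ x / (2 * k) := (Nat.le_div_iff_mul_le (by omega)).2 hcon
    have := (MCQ.semigroup_mem k (x % (2 * k)) (x / (2 * k)) (by omega) hlt).2 (by omega)
    rwa [mul_comm (x / (2 * k)), hdm] at this
  have hP0 : 0 ∉ P := by
    rw [hP]; push Not; exact ⟨0, 0, by simp⟩
  obtain ⟨mu, hmu⟩ := MCQ.exists_partition P hP0
  have hle := hκmax mu
    (MCQ.closed_core mu _ (by
      intro y
      rw [hmu, hP, hP]
      intro h
      contrapose! h
      obtain ⟨u, v, rfl⟩ := h
      exact ⟨u + 1, v, by ring⟩))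
    (MCQ.closed_core mu _ (by
      intro y
      rw [hmu, hP, hP]
      intro h
      contrapose! h
      obtain ⟨u, v, rfl⟩ := h
      exact ⟨u, v + 1, by ring⟩))
  have hcop : Nat.Coprime (2 * k + 1) (2 * k - 1) := by
    have h1 : 2 * k + 1 = 2 + (2 * k - 1) := by omega
    rw [h1, Nat.coprime_add_self_left]
    rw [Nat.coprime_two_left, Nat.odd_iff]
    omega
  have hd : MCQ.dsize P ≤ MCQ.dsize κ.minBeadSet := by
    rw [← hmu, ← MCQ.size_dsize, ← MCQ.size_dsize]
    exact_mod_cast Nat.mul_le_mul_left 2 hle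
  obtain ⟨hX, hcard⟩ := MCQ.key (2 * k - 1) (2 * k + 1) (by omega) (by omega) hcop P κ.minBeadSet hP
    (MCQ.zero_notMem κ) (MCQ.core_closed κ _ (by omega) hκcore.1)
    (MCQ.core_closed κ _ (by omega) hκcore.2) hd
  constructor
  · refine ⟨0, rfl, ?_, by intro k' hk'; omega⟩
    change (κ.minBeadSet).card % (2 * k) = 0
    rw [hX]
    obtain ⟨q, rfl⟩ : ∃ q, k = q + 1 := ⟨k - 1, by omega⟩
    have e : 2 * (q + 1) - 1 = 2 * q + 1 := by omega
    rw [e] at hcard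
    push_cast at hcard
    have : (P.card : ℤ) = ((2 * (q + 1) * q : ℕ) : ℤ) := by push_cast; linarith
    have h2 : P.card = 2 * (q + 1) * q := by exact_mod_cast this
    rw [h2]
    exact Nat.mul_mod_right _ _
  · intro i hi
    rw [hX]
    constructor
    · refine ⟨i, ?_⟩
      ext j
      rw [MCQ.mem_runner _ _ (by omega), hP, MCQ.semigroup_mem k i j (by omega) (by omega),
        MCQ.staircase_bead]
      omega
    · refine ⟨i, ?_⟩
      ext j
      rw [MCQ.mem_runner _ _ (by omega), hP, MCQ.semigroup_mem k _ j (by omega) (by omega),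
        MCQ.staircase_bead]
      omega
end

section
/- Let s = 2k > 2 be even. For all integers i, j with 0 ≤ i ≤ k−1 and 0 ≤ j ≤ s−3, each of the integers i + js and (s−1−i) + js belongs to P_{s−1,s+1} if and only if either j < i, or both i < j ≤ 2k−3−i and j − i is odd. Moreover, every element of P_{s−1,s+1} equals i + js or (s−1−i) + js for some such pair (i,j). -/
theorem rep_back (s r j : ℕ) (hs : 2 < s) (he : s % 2 = 0) (hr : r < s)
    (h : (r ≤ j ∧ (j + r) % 2 = 0) ∨ (s ≤ j + 1 + r ∧ (j + r) % 2 = 1)) :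
    ∃ a b : ℕ, r + j * s = a * (s - 1) + b * (s + 1) := by
  obtain ⟨t, rfl⟩ : ∃ t, s = t + 1 := ⟨s - 1, by omega⟩
  rcases h with ⟨h1, h2⟩ | ⟨h1, h2⟩
  · obtain ⟨a, ha⟩ : ∃ a, j = r + 2 * a := ⟨(j - r) / 2, by omega⟩
    refine ⟨a, a + r, ?_⟩
    subst ha
    simp only [Nat.add_sub_cancel]
    ring
  · obtain ⟨b, hb⟩ : ∃ b, j + 1 + r = t + 1 + 2 * b := ⟨(j + 1 + r - (t + 1)) / 2, by omega⟩
    obtain ⟨d, hd⟩ : ∃ d, t + 1 = r + d := ⟨t + 1 - r, by omega⟩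
    refine ⟨b + d, b, ?_⟩
    have hj : j + 1 = d + 2 * b := by omega
    simp only [Nat.add_sub_cancel]
    zify at *
    have hj' : (j : ℤ) = d + 2 * b - 1 := by linarith
    have hr' : (r : ℤ) = t + 1 - d := by linarith
    rw [hj', hr']
    ring

theorem rep_iff (s r j : ℕ) (hs : 2 < s) (he : s % 2 = 0) (hr : r < s) (hj : j ≤ s - 3) :
    (∃ a b : ℕ, r + j * s = a * (s - 1) + b * (s + 1)) ↔
    ((r ≤ j ∧ (j + r) % 2 = 0) ∨ (s ≤ j + 1 + r ∧ (j + r) % 2 = 1)) := by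
  refine ⟨?_, rep_back s r j hs he hr⟩
  rintro ⟨a, b, h⟩
  obtain ⟨t, rfl⟩ : ∃ t, s = t + 1 := ⟨s - 1, by omega⟩
  simp only [Nat.add_sub_cancel] at h
  have h' : r + j * (t + 1) + a = (a + b) * (t + 1) + b := by rw [h]; ring
  obtain ⟨m, hm⟩ : ∃ m, m = a + b := ⟨_, rfl⟩
  rw [← hm] at h'
  rcases lt_or_ge m j with hlt | hge
  · obtain ⟨e, rfl⟩ : ∃ e, j = m + 1 + e := ⟨j - m - 1, by omega⟩
    exfalso
    have : r + (t + 1) + e * (t + 1) + a = b := by nlinarith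
    have : 0 ≤ e * (t + 1) := Nat.zero_le _
    omega
  · obtain ⟨e, rfl⟩ : ∃ e, m = j + e := ⟨m - j, by omega⟩
    have h2 : r + a = e * (t + 1) + b := by nlinarith
    rcases e with _ | _ | e
    · omega
    · omega
    · exfalso
      have : (e + 1 + 1) * (t + 1) = e * t + e + 2 * t + 2 := by ring
      have : 0 ≤ e * t := Nat.zero_le _
      omega

/-- Let `s = 2k > 2` be even.  For `0 ≤ i ≤ k-1` and `0 ≤ j ≤ s-3`, each of
`i + js` and `(s-1-i) + js` lies in `P_{s-1,s+1}` iff either `j < i`, or both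
`i < j ≤ 2k-3-i` and `j - i` is odd.  Moreover every element of `P_{s-1,s+1}` is of the
form `i + js` or `(s-1-i) + js` for some such pair `(i, j)`. -/
theorem abacus_description_of_P (s k : ℕ) (hs : s = 2 * k) (hs2 : 2 < s) :
    (∀ i j : ℕ, i ≤ k - 1 → j ≤ s - 3 →
      ((i + j * s ∈ Pst (s - 1) (s + 1) ↔
          (j < i ∨ (i < j ∧ j ≤ 2 * k - 3 - i ∧ Odd (j - i)))) ∧
       ((s - 1 - i) + j * s ∈ Pst (s - 1) (s + 1) ↔
          (j < i ∨ (i < j ∧ j ≤ 2 * k - 3 - i ∧ Odd (j - i)))))) ∧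
    (∀ n ∈ Pst (s - 1) (s + 1), ∃ i j : ℕ, i ≤ k - 1 ∧ j ≤ s - 3 ∧
      (n = i + j * s ∨ n = (s - 1 - i) + j * s)) := by
  have key : ∀ n, n ∈ Pst (s - 1) (s + 1) ↔ ¬ ∃ a b : ℕ, n = a * (s - 1) + b * (s + 1) := by
    intro n
    refine ⟨fun h => h.2, fun h => ⟨?_, h⟩⟩
    rcases Nat.eq_zero_or_pos n with h0 | h0
    · exact absurd ⟨0, 0, by simp [h0]⟩ h
    · exact h0
  refine ⟨fun i j hi hj => ⟨?_, ?_⟩, fun n hn => ?_⟩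
  · rw [key, rep_iff s i j hs2 (by omega) (by omega) hj, Nat.odd_iff]
    omega
  · rw [key, rep_iff s (s - 1 - i) j hs2 (by omega) (by omega) hj, Nat.odd_iff]
    omega
  · rw [key] at hn
    have hdm : n = n % s + (n / s) * s := by
      rw [mul_comm]; exact (Nat.mod_add_div n s).symm
    have hr : n % s < s := Nat.mod_lt _ (by omega)
    generalize n % s = r at hdm hr
    generalize n / s = j at hdm
    subst hdm
    have hj : j ≤ s - 3 := by
      by_contra hj
      exact hn (rep_back s r j hs2 (by omega) hr (by omega))
    rcases le_or_gt r (k - 1) with h | h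
    · exact ⟨r, j, h, hj, Or.inl rfl⟩
    · refine ⟨s - 1 - r, j, by omega, hj, Or.inr ?_⟩
      have : s - 1 - (s - 1 - r) = r := by omega
      rw [this]
end

section
/- Let s = 2k > 2 be even. Then the size of κ_{s−1,s+1}, the (s−1,s+1)-core of maximal size, equals 4 times the maximal size of a partition that is simultaneously an (s−1)-core, an s-core, and an (s+1)-core; equivalently, |κ_{s−1,s+1}| = 4·k·C(k+1,3), where C(k+1,3) is the binomial coefficient. -/
namespace CoreMax

/-- A bead set is closed under subtracting `s`. -/
def Closed (s : ℕ) (X : Finset ℕ) : Prop := ∀ x ∈ X, s ≤ x → x - s ∈ X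

/-- The bead set with `M` beads. -/
def beads (lam : NPartition) (M : ℕ) : Finset ℕ :=
  (Finset.range M).image (fun i => lam.parts i + (M - 1 - i))

theorem conj_spec (lam : NPartition) (i j : ℕ) :
    j < lam.parts i ↔ i < lam.conj.parts j := by
  have hex : ∃ i, lam.parts i ≤ j := by
    obtain ⟨N, hN⟩ := lam.eventually_zero
    exact ⟨N, by rw [hN N le_rfl]; exact Nat.zero_le _⟩
  have hr : ∀ i, j < lam.parts i ↔ i < Nat.find hex := by
    intro i
    constructor
    · intro h
      by_contra hc
      have h1 := Nat.find_spec hex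
      have h2 := lam.antitone (not_lt.mp hc)
      omega
    · intro h
      have := Nat.find_min hex h
      omega
  have hne : ({N | lam.parts N = 0} : Set ℕ).Nonempty := by
    obtain ⟨N, hN⟩ := lam.eventually_zero
    exact ⟨N, hN N le_rfl⟩
  have hnum : lam.parts lam.numParts = 0 := Nat.sInf_mem hne
  have hf : (Finset.range lam.numParts).filter (fun i => j < lam.parts i)
      = Finset.range (Nat.find hex) := by
    ext a
    simp only [Finset.mem_filter, Finset.mem_range]
    rw [← hr]
    constructor
    · exact fun h => h.2
    · intro h
      refine ⟨?_, h⟩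
      by_contra hc
      have := lam.antitone (not_lt.mp hc)
      omega
  have : lam.conj.parts j = Nat.find hex := by
    show ((Finset.range lam.numParts).filter (fun i => j < lam.parts i)).card = _
    rw [hf, Finset.card_range]
  rw [this]
  exact hr i

theorem conj_eq (lam : NPartition) (j r : ℕ) (h : ∀ i, j < lam.parts i ↔ i < r) :
    lam.conj.parts j = r := by
  have h1 : ∀ i, i < lam.conj.parts j ↔ i < r := fun i => by rw [← conj_spec, h]
  have a := h1 r
  have b := h1 (lam.conj.parts j)
  omega

theorem isCore_iff (lam : NPartition) (M : ℕ) (hM : ∀ i, M ≤ i → lam.parts i = 0)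
    (s : ℕ) (hs : 0 < s) : lam.IsCore s ↔ Closed s (beads lam M) := by
  constructor
  · intro hcore x hx hsx
    by_contra hy
    simp only [beads, Finset.mem_image, Finset.mem_range, not_exists, not_and] at hx hy
    obtain ⟨i, hi, hxi⟩ := hx
    obtain ⟨y, hy'⟩ : ∃ y, y = x - s := ⟨_, rfl⟩
    rw [← hy'] at hy
    have hex : ∃ r, lam.parts r + M ≤ y + r + 1 := ⟨M, by rw [hM M le_rfl]; omega⟩
    obtain ⟨r, hrd⟩ : ∃ r, r = Nat.find hex := ⟨_, rfl⟩
    have hspec : lam.parts r + M ≤ y + r + 1 := hrd ▸ Nat.find_spec hex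
    have hmin : ∀ m, m < r → ¬ (lam.parts m + M ≤ y + m + 1) := by
      intro m hm
      rw [hrd] at hm
      exact Nat.find_min hex hm
    have hrM : r ≤ M := by
      rw [hrd]
      exact Nat.find_min' hex (by rw [hM M le_rfl]; omega)
    have hr2 : lam.parts r + M ≤ y + r := by
      rcases lt_or_eq_of_le hrM with h | h
      · have := hy r h
        omega
      · have := hM r h.ge
        omega
    have hc : lam.conj.parts (y + r - M) = r := by
      apply conj_eq
      intro a
      constructor
      · intro h
        by_contra hc
        have := lam.antitone (not_lt.mp hc)
        omega
      · intro h
        have h1 := hmin (r - 1) (by omega)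
        have h2 := lam.antitone (show a ≤ r - 1 by omega)
        omega
    have hir : i < r := by
      by_contra hc
      have := lam.antitone (not_lt.mp hc)
      omega
    have hbox : y + r - M < lam.parts i := by
      rw [conj_spec, hc]; exact hir
    apply hcore i _ hbox
    unfold NPartition.hookLength
    rw [hc]
    omega
  · intro hcl i j hij hh
    have hir := (conj_spec lam i j).1 hij
    obtain ⟨r, hr⟩ : ∃ r, r = lam.conj.parts j := ⟨_, rfl⟩
    have hrM : r ≤ M := by
      by_contra hc
      have h1 := (conj_spec lam M j).2 (by omega)
      have := hM M le_rfl
      omega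
    unfold NPartition.hookLength at hh
    rw [← hr] at hh hir
    have hm : lam.parts i + (M - 1 - i) ∈ beads lam M :=
      Finset.mem_image.2 ⟨i, Finset.mem_range.2 (by omega), rfl⟩
    have := hcl _ hm (by omega)
    obtain ⟨i', hi', he⟩ := Finset.mem_image.1 this
    rw [Finset.mem_range] at hi'
    have h3 := conj_spec lam i' j
    rw [← hr] at h3
    by_cases h : i' < r
    · have := h3.2 h
      omega
    · have : ¬ j < lam.parts i' := fun h' => h (h3.1 h')
      omega

theorem beads_injOn (lam : NPartition) (M : ℕ) :
    Set.InjOn (fun i => lam.parts i + (M - 1 - i)) (Finset.range M : Finset ℕ) := by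
  intro a ha b hb hab
  simp only [Finset.coe_range, Set.mem_Iio] at ha hb hab
  rcases lt_trichotomy a b with h | h | h
  · have := lam.antitone h.le; omega
  · exact h
  · have := lam.antitone h.le; omega

theorem card_beads (lam : NPartition) (M : ℕ) : (beads lam M).card = M := by
  rw [beads, Finset.card_image_of_injOn (beads_injOn lam M), Finset.card_range]

theorem size_beads (lam : NPartition) (M : ℕ) (hM : ∀ i, M ≤ i → lam.parts i = 0) :
    (2 * lam.size + M * (M - 1) : ℕ) = 2 * ∑ x ∈ beads lam M, x := by
  have h1 : lam.size = ∑ i ∈ Finset.range M, lam.parts i := by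
    unfold NPartition.size
    apply finsum_eq_sum_of_support_subset
    intro i hi
    simp only [Function.mem_support] at hi
    simp only [Finset.coe_range, Set.mem_Iio]
    by_contra h
    exact hi (hM i (not_lt.mp h))
  rw [beads, Finset.sum_image (beads_injOn lam M), Finset.sum_add_distrib, h1,
    Finset.sum_range_reflect (fun i => i) M, mul_add, mul_comm 2 (∑ i ∈ Finset.range M, i),
    Finset.sum_range_id_mul_two]

/-- Everything needed about `lam` is contained in a bead set. -/
def Rep (lam : NPartition) (X : Finset ℕ) : Prop :=
  (∀ s, 0 < s → (lam.IsCore s ↔ Closed s X)) ∧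
    (2 * lam.size + X.card * (X.card - 1) : ℕ) = 2 * ∑ x ∈ X, x

theorem rep_beads (lam : NPartition) (M : ℕ) (hM : ∀ i, M ≤ i → lam.parts i = 0) :
    Rep lam (beads lam M) :=
  ⟨fun s hs => isCore_iff lam M hM s hs, by rw [card_beads]; exact size_beads lam M hM⟩

theorem exists_rep (lam : NPartition) : ∃ X, Rep lam X := by
  obtain ⟨N, hN⟩ := lam.eventually_zero
  exact ⟨_, rep_beads lam N hN⟩

theorem exists_enum (X : Finset ℕ) : ∃ e : ℕ → ℕ,
    (∀ i j, i < j → j < X.card → e i < e j) ∧ (Finset.range X.card).image e = X := by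
  refine ⟨fun i => if h : i < X.card then X.orderEmbOfFin rfl ⟨i, h⟩ else 0, ?_, ?_⟩
  · intro i j hij hj
    simp only [hj, hij.trans hj, dif_pos]
    exact (X.orderEmbOfFin rfl).strictMono hij
  · ext x
    simp only [Finset.mem_image, Finset.mem_range]
    constructor
    · rintro ⟨i, hi, rfl⟩
      simp only [hi, dif_pos]
      exact Finset.orderEmbOfFin_mem _ _ _
    · intro hx
      have : x ∈ Set.range (X.orderEmbOfFin rfl) := by
        rw [Finset.range_orderEmbOfFin]; exact hx
      obtain ⟨⟨i, hi⟩, h⟩ := this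
      exact ⟨i, hi, by simp only [hi, dif_pos]; exact h⟩

theorem enum_gap {N : ℕ} {e : ℕ → ℕ} (he : ∀ i j, i < j → j < N → e i < e j) (d : ℕ) :
    ∀ i, i + d < N → e i + d ≤ e (i + d) := by
  induction d with
  | zero => intro _ _; simp
  | succ d ih =>
    intro i hi
    have h1 := ih i (by omega)
    have h2 := he (i + d) (i + (d + 1)) (by omega) hi
    omega

theorem exists_partition (X : Finset ℕ) : ∃ lam : NPartition, Rep lam X := by
  obtain ⟨e, he, hX⟩ := exists_enum X
  obtain ⟨m, hm⟩ : ∃ m, m = X.card := ⟨_, rfl⟩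
  rw [← hm] at he hX
  let lam : NPartition :=
    { parts := fun i => if i < m then e (m - 1 - i) - (m - 1 - i) else 0
      antitone := by
        intro i j hij
        by_cases hj : j < m
        · have hi : i < m := by omega
          simp only [hi, hj, if_true]
          have := enum_gap he (j - i) (m - 1 - j) (by omega)
          rw [show m - 1 - j + (j - i) = m - 1 - i by omega] at this
          omega
        · simp [hj]
      eventually_zero := ⟨m, fun i hi => by simp [not_lt.mpr hi]⟩ }
  have hb : beads lam m = X := by
    rw [← hX]
    ext x
    simp only [beads, Finset.mem_image, Finset.mem_range]
    have key : ∀ i, i < m → lam.parts i + (m - 1 - i) = e (m - 1 - i) := by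
      intro i hi
      show (if i < m then e (m - 1 - i) - (m - 1 - i) else 0) + _ = _
      have := enum_gap he (m - 1 - i) 0 (by omega)
      rw [zero_add] at this
      simp only [hi, if_true]
      omega
    constructor
    · rintro ⟨i, hi, rfl⟩
      exact ⟨m - 1 - i, by omega, (key i hi).symm⟩
    · rintro ⟨i, hi, rfl⟩
      refine ⟨m - 1 - i, by omega, ?_⟩
      rw [key _ (by omega)]
      congr 1
      omega
  refine ⟨lam, ?_⟩
  rw [← hb]
  apply rep_beads
  intro i hi
  show (if i < m then e (m - 1 - i) - (m - 1 - i) else 0) = 0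
  simp [not_lt.mpr hi]

end CoreMax

namespace CoreMax

/-- `n²` times the covariance of two functions on `{0, …, n-1}`. -/
def cov (n : ℕ) (u v : ℕ → ℤ) : ℤ :=
  n * ∑ i ∈ Finset.range n, u i * v i
    - (∑ i ∈ Finset.range n, u i) * ∑ i ∈ Finset.range n, v i

theorem sum_id (n : ℕ) : 2 * ∑ i ∈ Finset.range n, (i : ℤ) = n * (n - 1) := by
  induction n with
  | zero => simp
  | succ n ih => rw [Finset.sum_range_succ, mul_add, ih]; push_cast; ring

theorem sum_sq (n : ℕ) :
    6 * ∑ i ∈ Finset.range n, (i : ℤ) ^ 2 = n * (n - 1) * (2 * n - 1) := by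
  induction n with
  | zero => simp
  | succ n ih => rw [Finset.sum_range_succ, mul_add, ih]; push_cast; ring

theorem closed_iter {n : ℕ} {X : Finset ℕ} (h : Closed n X) (t : ℕ) :
    ∀ x, x + n * t ∈ X → x ∈ X := by
  induction t with
  | zero => intro x hx; simpa using hx
  | succ t ih =>
    intro x hx
    apply ih
    have := h _ hx (by rw [mul_add, mul_one]; omega)
    rwa [show x + n * (t + 1) - n = x + n * t by rw [mul_add, mul_one]; omega] at this

theorem sum_res (n : ℕ) (β : ℕ → ℕ) (hn : 0 < n)
    (hinj : ∀ i < n, ∀ j < n, β i % n = β j % n → i = j) (g : ℕ → ℤ) :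
    ∑ j ∈ Finset.range n, g (β j % n) = ∑ r ∈ Finset.range n, g r := by
  have hi : Set.InjOn (fun j => β j % n) (Finset.range n : Finset ℕ) := by
    intro a ha b hb hab
    simp only [Finset.coe_range, Set.mem_Iio] at ha hb
    exact hinj a ha b hb hab
  have him : (Finset.range n).image (fun j => β j % n) = Finset.range n := by
    apply Finset.eq_of_subset_of_card_le
    · intro x hx
      obtain ⟨j, _, rfl⟩ := Finset.mem_image.1 hx
      exact Finset.mem_range.2 (Nat.mod_lt _ hn)
    · rw [Finset.card_image_of_injOn hi]
  conv_rhs => rw [← him]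
  rw [Finset.sum_image hi]

theorem sum_abacus (n : ℕ) (hn : 0 < n) (X : Finset ℕ) (hX : Closed n X) (β : ℕ → ℕ)
    (hgap : ∀ j < n, β j ∉ X) (hbead : ∀ j < n, n ≤ β j → β j - n ∈ X)
    (hinj : ∀ i < n, ∀ j < n, β i % n = β j % n → i = j) (g : ℕ → ℤ) :
    ∑ x ∈ X, g x =
      ∑ j ∈ Finset.range n, ∑ t ∈ Finset.range (β j / n), g (β j % n + n * t) := by
  have h1 : ∑ x ∈ X, g x = ∑ r ∈ Finset.range n, ∑ x ∈ X with x % n = r, g x :=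
    (Finset.sum_fiberwise_of_maps_to
      (fun x _ => Finset.mem_range.2 (Nat.mod_lt x hn)) g).symm
  rw [h1, ← sum_res n β hn hinj (fun r => ∑ x ∈ X with x % n = r, g x)]
  apply Finset.sum_congr rfl
  intro j hj
  rw [Finset.mem_range] at hj
  have hf : X.filter (fun x => x % n = β j % n)
      = (Finset.range (β j / n)).image (fun t => β j % n + n * t) := by
    ext x
    simp only [Finset.mem_filter, Finset.mem_image, Finset.mem_range]
    have hβ := Nat.mod_add_div (β j) n
    have hx := Nat.mod_add_div x n
    constructor
    · rintro ⟨hxX, hxr⟩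
      refine ⟨x / n, ?_, by omega⟩
      by_contra hc
      apply hgap j hj
      apply closed_iter hX (x / n - β j / n)
      have : β j + n * (x / n - β j / n) = x := by
        rw [Nat.mul_sub]
        have := Nat.mul_le_mul_left n (not_lt.mp hc)
        omega
      rwa [this]
    · rintro ⟨t, ht, rfl⟩
      refine ⟨?_, by simp⟩
      have hge : n * 1 ≤ n * (β j / n) := Nat.mul_le_mul_left n (by omega)
      have := hbead j hj (by omega)
      apply closed_iter hX (β j / n - 1 - t)
      have e : β j % n + n * t + n * (β j / n - 1 - t) = β j - n := by
        have e2 : n * t + n * (β j / n - 1 - t) + n = n * (β j / n) := by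
          rw [← mul_add, show t + (β j / n - 1 - t) = β j / n - 1 by omega]
          rw [← Nat.mul_succ, Nat.succ_eq_add_one, show β j / n - 1 + 1 = β j / n by omega]
        omega
      rwa [e]
  rw [hf, Finset.sum_image]
  intro a _ b _ hab
  have : n * a = n * b := by simpa using hab
  exact Nat.eq_of_mul_eq_mul_left hn this

theorem size_formula (lam : NPartition) (X : Finset ℕ) (hrep : Rep lam X)
    (n : ℕ) (hn : 0 < n) (hX : Closed n X) (β : ℕ → ℕ)
    (hgap : ∀ j < n, β j ∉ X) (hbead : ∀ j < n, n ≤ β j → β j - n ∈ X)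
    (hinj : ∀ i < n, ∀ j < n, β i % n = β j % n → i = j) :
    24 * (n : ℤ) ^ 2 * lam.size
      = 12 * cov n (fun j => (β j : ℤ)) (fun j => (β j : ℤ)) - (n : ℤ) ^ 2 * ((n : ℤ) ^ 2 - 1) := by
  have hs := hrep.2
  have hs' : 2 * (lam.size : ℤ) + X.card * (X.card - 1) = 2 * ∑ x ∈ X, (x : ℤ) := by
    have h2 : ((X.card * (X.card - 1) : ℕ) : ℤ) = X.card * ((X.card : ℤ) - 1) := by
      rcases Nat.eq_zero_or_pos X.card with h | h
      · simp [h]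
      · push_cast [Nat.cast_sub h]; ring
    rw [← h2]
    generalize X.card * (X.card - 1) = w at hs
    have h3 := congrArg (Nat.cast : ℕ → ℤ) hs
    push_cast at h3
    exact h3
  have hcard := sum_abacus n hn X hX β hgap hbead hinj (fun _ => 1)
  have hsum := sum_abacus n hn X hX β hgap hbead hinj (fun x => (x : ℤ))
  simp only [Finset.sum_const, Finset.card_range, nsmul_eq_mul, mul_one] at hcard
  have hin : ∀ j, 2 * ∑ t ∈ Finset.range (β j / n), ((β j % n + n * t : ℕ) : ℤ)
      = 2 * ((β j % n : ℕ) : ℤ) * (β j / n : ℕ)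
        + n * (((β j / n : ℕ) : ℤ) * (((β j / n : ℕ) : ℤ) - 1)) := by
    intro j
    push_cast [Finset.sum_add_distrib, ← Finset.mul_sum]
    have := sum_id (β j / n)
    push_cast at this
    simp only [Finset.sum_const, Finset.card_range, nsmul_eq_mul]
    push_cast
    linear_combination (n : ℤ) * this
  have hsum2 : 2 * ∑ x ∈ X, (x : ℤ) = ∑ j ∈ Finset.range n,
      (2 * ((β j % n : ℕ) : ℤ) * (β j / n : ℕ)
        + n * (((β j / n : ℕ) : ℤ) * (((β j / n : ℕ) : ℤ) - 1))) := by
    rw [hsum, Finset.mul_sum]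
    exact Finset.sum_congr rfl (fun j _ => hin j)
  have hr1 := sum_res n β hn hinj (fun r => (r : ℤ))
  have hr2 := sum_res n β hn hinj (fun r => (r : ℤ) ^ 2)
  have hi1 := sum_id n
  have hi2 := sum_sq n
  rw [← hr1] at hi1
  rw [← hr2] at hi2
  have hβ : ∀ j, (β j : ℤ) = ((β j % n : ℕ) : ℤ) + n * (β j / n : ℕ) := by
    intro j
    exact_mod_cast (Nat.mod_add_div (β j) n).symm
  generalize hrd : (fun j => ((β j % n : ℕ) : ℤ)) = r at *
  generalize hcd : (fun j => ((β j / n : ℕ) : ℤ)) = c at *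
  have hrd' : ∀ j, ((β j % n : ℕ) : ℤ) = r j := fun j => congrFun hrd j
  have hcd' : ∀ j, ((β j / n : ℕ) : ℤ) = c j := fun j => congrFun hcd j
  simp only [hrd', hcd'] at *
  have e1 : ∑ j ∈ Finset.range n, (β j : ℤ)
      = ∑ j ∈ Finset.range n, r j + n * ∑ j ∈ Finset.range n, c j := by
    rw [Finset.mul_sum, ← Finset.sum_add_distrib]
    exact Finset.sum_congr rfl (fun j _ => hβ j)
  have e2 : ∑ j ∈ Finset.range n, (β j : ℤ) * β j
      = ∑ j ∈ Finset.range n, r j ^ 2 + 2 * n * ∑ j ∈ Finset.range n, r j * c j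
        + n ^ 2 * ∑ j ∈ Finset.range n, c j ^ 2 := by
    rw [Finset.mul_sum, Finset.mul_sum, ← Finset.sum_add_distrib, ← Finset.sum_add_distrib]
    exact Finset.sum_congr rfl (fun j _ => by rw [hβ j]; ring)
  have e3 : 2 * ∑ x ∈ X, (x : ℤ) = 2 * ∑ j ∈ Finset.range n, r j * c j
      + n * ∑ j ∈ Finset.range n, c j ^ 2 - n * ∑ j ∈ Finset.range n, c j := by
    rw [hsum2, Finset.mul_sum, Finset.mul_sum, Finset.mul_sum, ← Finset.sum_add_distrib,
      ← Finset.sum_sub_distrib]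
    exact Finset.sum_congr rfl (fun j _ => by ring)
  unfold cov
  rw [e1, e2]
  rw [e3, hcard] at hs'
  generalize ∑ j ∈ Finset.range n, r j = R1 at *
  generalize ∑ j ∈ Finset.range n, c j = C1 at *
  generalize ∑ j ∈ Finset.range n, r j ^ 2 = R2 at *
  generalize ∑ j ∈ Finset.range n, c j ^ 2 = C2 at *
  generalize ∑ j ∈ Finset.range n, r j * c j = RC at *
  have hR : R1 * R1 * 4 = (n * (n - 1)) ^ 2 := by rw [← hi1]; ring
  linear_combination 12 * (n : ℤ) ^ 2 * hs' - 2 * (n : ℤ) * hi2 + 3 * hR + 12 * n * C1 * hi1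

end CoreMax

namespace CoreMax

/-- The sawtooth function with a jump after `p`. -/
def tooth (n p i : ℕ) : ℤ := n * (if p < i then 1 else 0) - i

/-- The sum of sawtooth functions with jumps at `A`. -/
def saw (n : ℕ) (A : Finset ℕ) (i : ℕ) : ℤ := ∑ p ∈ A, tooth n p i

theorem saw_zero (n : ℕ) (A : Finset ℕ) : saw n A 0 = 0 := by
  simp [saw, tooth]

theorem saw_succ (n : ℕ) (A : Finset ℕ) (i : ℕ) :
    saw n A (i + 1) = saw n A i + (n * (if i ∈ A then 1 else 0) - A.card) := by
  have h : ∀ p, tooth n p (i + 1) = tooth n p i + (n * (if p = i then 1 else 0) - 1) := by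
    intro p
    unfold tooth
    rcases lt_trichotomy p i with h | h | h
    · simp [h, h.ne, h.trans (Nat.lt_succ_self i)]; ring
    · subst h; simp; ring
    · simp [h.ne', show ¬ p < i + 1 by omega, show ¬ p < i by omega]; ring
  unfold saw
  rw [Finset.sum_congr rfl (fun p _ => h p), Finset.sum_add_distrib, Finset.sum_sub_distrib,
    ← Finset.mul_sum]
  simp

theorem sum_ind (p : ℕ) (n : ℕ) (h : p < n) :
    ∑ i ∈ Finset.range n, (if p < i then (1 : ℤ) else 0) = n - 1 - p := by
  induction n with
  | zero => omega
  | succ n ih =>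
    rw [Finset.sum_range_succ]
    by_cases hp : p < n
    · rw [ih hp, if_pos hp]; push_cast; ring
    · have hpn : p = n := by omega
      subst hpn
      rw [Finset.sum_eq_zero]
      · simp
      · intro i hi
        rw [Finset.mem_range] at hi
        rw [if_neg (by omega)]

theorem sum_ind_id (p : ℕ) (n : ℕ) (h : p < n) :
    2 * ∑ i ∈ Finset.range n, (if p < i then (1 : ℤ) else 0) * i = n * (n - 1) - p * (p + 1) := by
  induction n with
  | zero => omega
  | succ n ih =>
    rw [Finset.sum_range_succ]
    by_cases hp : p < n
    · rw [mul_add, ih hp, if_pos hp]; push_cast; ring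
    · have hpn : p = n := by omega
      subst hpn
      rw [Finset.sum_eq_zero]
      · simp; ring
      · intro i hi
        rw [Finset.mem_range] at hi
        rw [if_neg (by omega), zero_mul]

theorem cov_tooth_le (n p q : ℕ) (hpq : p ≤ q) (hq : q < n) :
    12 * cov n (tooth n p) (tooth n q)
      = (n : ℤ) ^ 2 * ((n : ℤ) ^ 2 - 1)
        + 6 * (n : ℤ) ^ 2 * (((q : ℤ) - p) ^ 2 - n * ((q : ℤ) - p)) := by
  have hp : p < n := by omega
  have a1 := sum_ind p n hp
  have a2 := sum_ind q n hq
  have b1 := sum_ind_id p n hp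
  have b2 := sum_ind_id q n hq
  have i1 := sum_id n
  have i2 := sum_sq n
  have e1 : ∀ p, ∑ i ∈ Finset.range n, tooth n p i
      = n * ∑ i ∈ Finset.range n, (if p < i then (1 : ℤ) else 0)
        - ∑ i ∈ Finset.range n, (i : ℤ) := by
    intro p
    unfold tooth
    rw [Finset.sum_sub_distrib, Finset.mul_sum]
  have e2 : ∑ i ∈ Finset.range n, tooth n p i * tooth n q i
      = n ^ 2 * ∑ i ∈ Finset.range n, (if q < i then (1 : ℤ) else 0)
        - n * ∑ i ∈ Finset.range n, (if p < i then (1 : ℤ) else 0) * i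
        - n * ∑ i ∈ Finset.range n, (if q < i then (1 : ℤ) else 0) * i
        + ∑ i ∈ Finset.range n, (i : ℤ) ^ 2 := by
    rw [Finset.mul_sum, Finset.mul_sum, Finset.mul_sum, ← Finset.sum_sub_distrib,
      ← Finset.sum_sub_distrib, ← Finset.sum_add_distrib]
    apply Finset.sum_congr rfl
    intro i _
    unfold tooth
    by_cases h : q < i
    · simp only [h, show p < i by omega, if_true]; ring
    · simp only [h, if_false]; ring
  unfold cov
  rw [e1, e1, e2, a1, a2]
  generalize ∑ i ∈ Finset.range n, (if p < i then (1 : ℤ) else 0) * i = P at *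
  generalize ∑ i ∈ Finset.range n, (if q < i then (1 : ℤ) else 0) * i = Q at *
  generalize ∑ i ∈ Finset.range n, (i : ℤ) ^ 2 = I2 at *
  generalize ∑ i ∈ Finset.range n, (i : ℤ) = I at *
  have hI : 4 * I * I = (n * (n - 1)) ^ 2 := by rw [← i1]; ring
  linear_combination (-6 * (n : ℤ) ^ 2) * b1 + (-6 * (n : ℤ) ^ 2) * b2 + 2 * n * i2 - 3 * hI
    + 6 * n * ((n - 1 - p) + (n - 1 - q)) * i1

theorem cov_comm (n : ℕ) (u v : ℕ → ℤ) : cov n u v = cov n v u := by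
  unfold cov
  rw [mul_comm (∑ i ∈ Finset.range n, u i)]
  congr 2
  exact Finset.sum_congr rfl (fun i _ => mul_comm _ _)

/-- The kernel. -/
def ker (n p q : ℕ) : ℤ := |(q : ℤ) - p| ^ 2 - n * |(q : ℤ) - p|

theorem cov_tooth (n p q : ℕ) (hp : p < n) (hq : q < n) :
    12 * cov n (tooth n p) (tooth n q)
      = (n : ℤ) ^ 2 * ((n : ℤ) ^ 2 - 1) + 6 * (n : ℤ) ^ 2 * ker n p q := by
  unfold ker
  rcases le_total p q with h | h
  · rw [cov_tooth_le n p q h hq, abs_of_nonneg (by have : (p : ℤ) ≤ q := by exact_mod_cast h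
                                                   linarith)]
  · rw [cov_comm, cov_tooth_le n q p h hp, abs_of_nonpos
      (by have : (q : ℤ) ≤ p := by exact_mod_cast h
          linarith)]
    ring

theorem cov_saw (n : ℕ) (A : Finset ℕ) (hA : ∀ p ∈ A, p < n) :
    12 * cov n (saw n A) (saw n A)
      = (n : ℤ) ^ 2 * ((n : ℤ) ^ 2 - 1) * (A.card : ℤ) ^ 2
        + 6 * (n : ℤ) ^ 2 * ∑ p ∈ A, ∑ q ∈ A, ker n p q := by
  have h1 : cov n (saw n A) (saw n A)
      = ∑ p ∈ A, ∑ q ∈ A, cov n (tooth n p) (tooth n q) := by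
    unfold cov saw
    simp only [Finset.sum_sub_distrib, ← Finset.mul_sum]
    congr 1
    · congr 1
      simp only [Finset.sum_mul_sum]
      rw [Finset.sum_comm]
      apply Finset.sum_congr rfl
      intro p _
      rw [Finset.sum_comm]
    · rw [Finset.sum_comm, ← Finset.sum_mul]
  rw [h1, Finset.mul_sum]
  have h2 : ∀ p ∈ A, 12 * ∑ q ∈ A, cov n (tooth n p) (tooth n q)
      = A.card * ((n : ℤ) ^ 2 * ((n : ℤ) ^ 2 - 1)) + 6 * (n : ℤ) ^ 2 * ∑ q ∈ A, ker n p q := by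
    intro p hp
    rw [Finset.mul_sum, Finset.sum_congr rfl (fun q hq => cov_tooth n p q (hA p hp) (hA q hq)),
      Finset.sum_add_distrib, Finset.sum_const, nsmul_eq_mul, ← Finset.mul_sum]
  rw [Finset.sum_congr rfl h2, Finset.sum_add_distrib, Finset.sum_const, nsmul_eq_mul,
    ← Finset.mul_sum]
  ring

theorem sum_abs (N : ℕ) : 3 * ∑ i ∈ Finset.range N, ∑ j ∈ Finset.range N, |(j : ℤ) - i|
    = N * ((N : ℤ) ^ 2 - 1) := by
  induction N with
  | zero => simp
  | succ N ih =>
    have e1 : ∑ i ∈ Finset.range N, |(N : ℤ) - i| = ∑ i ∈ Finset.range N, ((N : ℤ) - i) := by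
      apply Finset.sum_congr rfl
      intro i hi
      rw [Finset.mem_range] at hi
      exact abs_of_nonneg (by have : (i : ℤ) < N := by exact_mod_cast hi
                              linarith)
    have e2 : ∑ j ∈ Finset.range N, |(j : ℤ) - N| = ∑ i ∈ Finset.range N, ((N : ℤ) - i) := by
      rw [← e1]
      exact Finset.sum_congr rfl (fun i _ => abs_sub_comm _ _)
    rw [Finset.sum_range_succ]
    simp only [Finset.sum_range_succ, Finset.sum_add_distrib]
    rw [e1, e2, Finset.sum_sub_distrib]
    have := sum_id N
    simp
    linear_combination ih - 3 * this

theorem sum_dsq (N : ℕ) : 6 * ∑ i ∈ Finset.range N, ∑ j ∈ Finset.range N, |(j : ℤ) - i| ^ 2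
    = (N : ℤ) ^ 2 * ((N : ℤ) ^ 2 - 1) := by
  have h : ∀ i j : ℕ, |(j : ℤ) - i| ^ 2 = (j : ℤ) ^ 2 - 2 * (i * j) + (i : ℤ) ^ 2 := by
    intro i j
    rw [sq_abs]; ring
  simp only [h, Finset.sum_add_distrib, Finset.sum_sub_distrib, ← Finset.mul_sum,
    ← Finset.sum_mul]
  simp only [Finset.sum_const, Finset.card_range, nsmul_eq_mul, ← Finset.mul_sum]
  have a := sum_id N
  have b := sum_sq N
  generalize ∑ i ∈ Finset.range N, (i : ℤ) ^ 2 = I2 at *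
  generalize ∑ i ∈ Finset.range N, (i : ℤ) = I at *
  have hI : 4 * I * I = (N * (N - 1)) ^ 2 := by rw [← a]; ring
  linear_combination 2 * N * b - 3 * hI

theorem sum_ker_range (n N : ℕ) :
    6 * ∑ p ∈ Finset.range N, ∑ q ∈ Finset.range N, ker n p q
      = (N : ℤ) * ((N : ℤ) ^ 2 - 1) * (N - 2 * n) := by
  unfold ker
  simp only [Finset.sum_sub_distrib, ← Finset.mul_sum]
  have a := sum_abs N
  have b := sum_dsq N
  linear_combination b - 2 * n * a

/-- antisymmetric weight -/
def wt (N i j : ℕ) : ℤ :=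
  2 * ((j : ℤ) - i) - N * (1 - (if i = j then 1 else 0) - 2 * (if j < i then 1 else 0))

theorem wt_antisymm (N i j : ℕ) : wt N i j = - wt N j i := by
  unfold wt
  rcases lt_trichotomy i j with h | h | h
  · simp [h, h.ne, h.ne', not_lt.mpr h.le]; ring
  · subst h; simp
  · simp [h, h.ne, h.ne', not_lt.mpr h.le]; ring

theorem sum_wt (N j : ℕ) (hj : j < N) : ∑ i ∈ Finset.range N, wt N i j = 0 := by
  unfold wt
  rw [Finset.sum_sub_distrib, ← Finset.mul_sum, ← Finset.mul_sum, Finset.sum_sub_distrib,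
    Finset.sum_sub_distrib, Finset.sum_sub_distrib, ← Finset.mul_sum, sum_ind j N hj]
  have := sum_id N
  simp [hj]
  linear_combination -this

theorem sum_wt_mul (N : ℕ) (e : ℕ → ℤ) :
    ∑ i ∈ Finset.range N, ∑ j ∈ Finset.range N, wt N i j * (e j - e i) = 0 := by
  have h1 : ∑ i ∈ Finset.range N, ∑ j ∈ Finset.range N, wt N i j * e j = 0 := by
    rw [Finset.sum_comm]
    apply Finset.sum_eq_zero
    intro j hj
    rw [← Finset.sum_mul, sum_wt N j (Finset.mem_range.1 hj), zero_mul]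
  have h2 : ∑ i ∈ Finset.range N, ∑ j ∈ Finset.range N, wt N i j * e i = 0 := by
    apply Finset.sum_eq_zero
    intro i hi
    rw [← Finset.sum_mul]
    have : ∑ j ∈ Finset.range N, wt N i j = 0 := by
      rw [Finset.sum_congr rfl (fun j _ => wt_antisymm N i j), Finset.sum_neg_distrib,
        sum_wt N i (Finset.mem_range.1 hi), neg_zero]
    rw [this, zero_mul]
  simp only [mul_sub, Finset.sum_sub_distrib, h1, h2, sub_zero]

theorem ker_le (n N : ℕ) (e : ℕ → ℕ) (he : ∀ i j, i < j → j < N → e i < e j)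
    (hn : ∀ i, i < N → e i < n) (i j : ℕ) (hij : i ≤ j) (hj : j < N) :
    ker n (e i) (e j) ≤ wt N i j * ((e j : ℤ) - e i)
      - ((n : ℤ) - N) * |(j : ℤ) - i| - |(j : ℤ) - i| ^ 2 := by
  rcases eq_or_lt_of_le hij with h | h
  · subst h; simp [ker]
  · have g1 := enum_gap he (j - i) i (by omega)
    have g2 := enum_gap he (N - 1 - j) j (by omega)
    have g3 := enum_gap he i 0 (by omega)
    have g4 := hn (j + (N - 1 - j)) (by omega)
    rw [show i + (j - i) = j by omega] at g1
    rw [zero_add] at g3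
    have c1 : (e j : ℤ) - e i - (j - i) ≥ 0 := by omega
    have c2 : (n : ℤ) - N + (j - i) - ((e j : ℤ) - e i) ≥ 0 := by omega
    have c3 : (0 : ℤ) ≤ (e j : ℤ) - e i := by omega
    have c4 : (0 : ℤ) ≤ (j : ℤ) - i := by omega
    unfold ker wt
    rw [abs_of_nonneg c3, abs_of_nonneg c4, if_neg h.ne, if_neg (not_lt.mpr h.le)]
    nlinarith [mul_nonneg c1 c2]

theorem sum_ker_le (n : ℕ) (A : Finset ℕ) (hA : ∀ p ∈ A, p < n) :
    6 * ∑ p ∈ A, ∑ q ∈ A, ker n p q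
      ≤ (A.card : ℤ) * ((A.card : ℤ) ^ 2 - 1) * (A.card - 2 * n) := by
  obtain ⟨e, he, hX⟩ := exists_enum A
  obtain ⟨N, hN⟩ : ∃ N, N = A.card := ⟨_, rfl⟩
  rw [← hN] at he hX ⊢
  have hn : ∀ i, i < N → e i < n := by
    intro i hi
    apply hA
    rw [← hX]
    exact Finset.mem_image_of_mem _ (Finset.mem_range.2 hi)
  have hinj : Set.InjOn e (Finset.range N : Finset ℕ) := by
    intro a ha b hb hab
    simp only [Finset.coe_range, Set.mem_Iio] at ha hb
    rcases lt_trichotomy a b with h | h | h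
    · have := he a b h hb; omega
    · exact h
    · have := he b a h ha; omega
  have e1 : ∑ p ∈ A, ∑ q ∈ A, ker n p q
      = ∑ i ∈ Finset.range N, ∑ j ∈ Finset.range N, ker n (e i) (e j) := by
    conv_lhs => rw [← hX]
    rw [Finset.sum_image hinj]
    apply Finset.sum_congr rfl
    intro i _
    rw [Finset.sum_image hinj]
  have e2 : ∑ i ∈ Finset.range N, ∑ j ∈ Finset.range N, ker n (e i) (e j)
      ≤ ∑ i ∈ Finset.range N, ∑ j ∈ Finset.range N, (wt N i j * ((e j : ℤ) - e i)
        - ((n : ℤ) - N) * |(j : ℤ) - i| - |(j : ℤ) - i| ^ 2) := by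
    apply Finset.sum_le_sum
    intro i hi
    apply Finset.sum_le_sum
    intro j hj
    rw [Finset.mem_range] at hi hj
    rcases le_total i j with h | h
    · exact ker_le n N e he hn i j h hj
    · have := ker_le n N e he hn j i h hi
      rw [wt_antisymm, abs_sub_comm (j : ℤ)]
      have hk : ker n (e i) (e j) = ker n (e j) (e i) := by
        unfold ker; rw [abs_sub_comm]
      rw [hk]
      linarith
  rw [e1]
  simp only [Finset.sum_sub_distrib, ← Finset.mul_sum] at e2
  rw [sum_wt_mul N (fun i => (e i : ℤ))] at e2
  have a := sum_abs N
  have b := sum_dsq N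
  nlinarith

/-- The arc bound. -/
def arc (n N : ℤ) : ℤ := n ^ 2 * (N * (n - N)) * (N * (n - N) + 2)

theorem cov_saw_le (n : ℕ) (A : Finset ℕ) (hA : ∀ p ∈ A, p < n) :
    12 * cov n (saw n A) (saw n A) ≤ arc n A.card := by
  rw [cov_saw n A hA]
  have h := mul_le_mul_of_nonneg_left (sum_ker_le n A hA) (sq_nonneg (n : ℤ))
  unfold arc
  nlinarith

theorem cov_saw_range (n N : ℕ) (hN : N ≤ n) :
    12 * cov n (saw n (Finset.range N)) (saw n (Finset.range N)) = arc n N := by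
  rw [cov_saw n _ (fun p hp => lt_of_lt_of_le (Finset.mem_range.1 hp) hN)]
  have h := sum_ker_range n N
  rw [Finset.card_range]
  unfold arc
  linear_combination (n : ℤ) ^ 2 * h

theorem cov_saw_single (n p : ℕ) (hp : p < n) :
    12 * cov n (saw n {p}) (saw n {p}) = (n : ℤ) ^ 2 * ((n : ℤ) ^ 2 - 1) := by
  rw [cov_saw n _ (fun q hq => by rw [Finset.mem_singleton.1 hq]; exact hp)]
  simp [ker]

theorem cov_self_nonneg (n : ℕ) (u : ℕ → ℤ) : 0 ≤ cov n u u := by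
  unfold cov
  have := sq_sum_le_card_mul_sum_sq (s := Finset.range n) (f := u)
  rw [Finset.card_range] at this
  simp only [← sq]
  linarith

theorem cov_congr_shift (n : ℕ) (u v : ℕ → ℤ) (c : ℤ) (h : ∀ i < n, u i = c + v i) :
    cov n u u = cov n v v := by
  unfold cov
  have e1 : ∑ i ∈ Finset.range n, u i = n * c + ∑ i ∈ Finset.range n, v i := by
    rw [Finset.sum_congr rfl (fun i hi => h i (Finset.mem_range.1 hi)), Finset.sum_add_distrib]
    simp
  have e2 : ∑ i ∈ Finset.range n, u i * u i = n * c ^ 2 + 2 * c * ∑ i ∈ Finset.range n, v i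
      + ∑ i ∈ Finset.range n, v i * v i := by
    rw [Finset.sum_congr rfl (fun i hi => show u i * u i = c ^ 2 + 2 * c * v i + v i * v i by
      rw [h i (Finset.mem_range.1 hi)]; ring), Finset.sum_add_distrib, Finset.sum_add_distrib,
      ← Finset.mul_sum]
    simp
  rw [e1, e2]
  ring

theorem cov_parallelogram (n : ℕ) (u v w z : ℕ → ℤ) (hw : ∀ i < n, w i = u i + v i)
    (hz : ∀ i < n, z i = u i - v i) :
    cov n w w = 2 * cov n u u + 2 * cov n v v - cov n z z := by
  unfold cov
  have e1 : ∑ i ∈ Finset.range n, w i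
      = ∑ i ∈ Finset.range n, u i + ∑ i ∈ Finset.range n, v i := by
    rw [← Finset.sum_add_distrib]
    exact Finset.sum_congr rfl (fun i hi => hw i (Finset.mem_range.1 hi))
  have e2 : ∑ i ∈ Finset.range n, z i
      = ∑ i ∈ Finset.range n, u i - ∑ i ∈ Finset.range n, v i := by
    rw [← Finset.sum_sub_distrib]
    exact Finset.sum_congr rfl (fun i hi => hz i (Finset.mem_range.1 hi))
  have e3 : ∑ i ∈ Finset.range n, w i * w i = 2 * ∑ i ∈ Finset.range n, u i * u i
      + 2 * ∑ i ∈ Finset.range n, v i * v i - ∑ i ∈ Finset.range n, z i * z i := by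
    rw [Finset.mul_sum, Finset.mul_sum, ← Finset.sum_add_distrib, ← Finset.sum_sub_distrib]
    exact Finset.sum_congr rfl (fun i hi => by
      rw [hw i (Finset.mem_range.1 hi), hz i (Finset.mem_range.1 hi)]; ring)
  rw [e1, e2, e3]
  ring

end CoreMax

namespace CoreMax

theorem exists_gap (n : ℕ) (hn : 0 < n) (X : Finset ℕ) (r : ℕ) :
    ∃ b, b % n = r % n ∧ b ∉ X := by
  refine ⟨r + n * (X.sup id + 1), by simp, ?_⟩
  intro h
  have h1 : r + n * (X.sup id + 1) ≤ X.sup id := Finset.le_sup (f := id) h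
  nlinarith

theorem exists_firstGap (n : ℕ) (hn : 0 < n) (X : Finset ℕ) : ∃ g : ℕ → ℕ,
    (∀ r, g r % n = r % n) ∧ (∀ r, g r ∉ X) ∧ (∀ r, n ≤ g r → g r - n ∈ X) ∧
    (∀ r r', r % n = r' % n → g r = g r') ∧
    (∀ m, Closed m X → ∀ r, g (r + m) ≤ g r + m) := by
  classical
  have key : ∀ r : ℕ, ∃ b, (b % n = r % n ∧ b ∉ X) ∧ ∀ c, c % n = r % n → c ∉ X → b ≤ c := by
    intro r
    exact ⟨Nat.find (exists_gap n hn X r), Nat.find_spec (exists_gap n hn X r),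
      fun c h1 h2 => Nat.find_min' _ ⟨h1, h2⟩⟩
  choose g hg hmin using key
  refine ⟨g, fun r => (hg r).1, fun r => (hg r).2, ?_, ?_, ?_⟩
  · intro r hr
    by_contra hc
    have := hmin r (g r - n) (by
      rw [← (hg r).1]; exact (Nat.mod_eq_sub_mod hr).symm) hc
    omega
  · intro r r' h
    apply le_antisymm
    · exact hmin r _ ((hg r').1.trans h.symm) (hg r').2
    · exact hmin r' _ ((hg r).1.trans h) (hg r).2
  · intro m hm r
    apply hmin
    · rw [Nat.add_mod, (hg r).1, ← Nat.add_mod]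
    · intro h
      have := hm _ h (by omega)
      rw [Nat.add_sub_cancel] at this
      exact (hg r).2 this

theorem card_of_steps (n N : ℕ) (hn : 0 < n) (β : ℕ → ℤ) (A B : Finset ℕ)
    (hA : ∀ p ∈ A, p < n) (hB : ∀ p ∈ B, p < n)
    (hstep : ∀ j < n, β (j + 1) = β j
      + (n * ((if j ∈ A then 1 else 0) + (if j ∈ B then 1 else 0)) - N))
    (hper : β n = β 0) : A.card + B.card = N := by
  have h1 := Finset.sum_range_sub β n
  have hc : ∀ A : Finset ℕ, (∀ p ∈ A, p < n) →
      ∑ j ∈ Finset.range n, (if j ∈ A then (1 : ℤ) else 0) = A.card := by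
    intro A hA
    rw [Finset.sum_ite_mem, Finset.inter_eq_right.2 (fun p hp => Finset.mem_range.2 (hA p hp))]
    simp
  rw [Finset.sum_congr rfl (fun j hj => show β (j + 1) - β j
      = n * ((if j ∈ A then 1 else 0) + (if j ∈ B then 1 else 0)) - N by
      rw [hstep j (Finset.mem_range.1 hj)]; ring), Finset.sum_sub_distrib, ← Finset.mul_sum,
      Finset.sum_add_distrib, hc A hA, hc B hB, hper] at h1
  simp only [Finset.sum_const, Finset.card_range, nsmul_eq_mul] at h1
  have h2 : (n : ℤ) * ((A.card : ℤ) + B.card) = n * N := by linarith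
  have h3 := mul_left_cancel₀ (by exact_mod_cast hn.ne') h2
  exact_mod_cast h3

theorem eq_saw (n N : ℕ) (β : ℕ → ℤ) (A B : Finset ℕ) (hN : A.card + B.card = N)
    (hstep : ∀ j, j + 1 < n → β (j + 1) = β j
      + (n * ((if j ∈ A then 1 else 0) + (if j ∈ B then 1 else 0)) - N)) :
    ∀ i, i < n → β i = β 0 + (saw n A i + saw n B i) := by
  intro i
  induction i with
  | zero => intro _; simp [saw_zero]
  | succ i ih =>
    intro hi
    rw [hstep i hi, ih (by omega), saw_succ, saw_succ, ← hN]
    push_cast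
    ring

theorem coprime_aux (s k : ℕ) (hs : s = 2 * k) : Nat.Coprime (2 * s) (s + 1) := by
  apply Nat.Coprime.mul_left
  · rw [Nat.coprime_two_left, Nat.odd_iff]; omega
  · simp

theorem inj_aux (s k : ℕ) (hs : s = 2 * k) (i j : ℕ) (hi : i < 2 * s) (hj : j < 2 * s)
    (h : (i * (s + 1)) % (2 * s) = (j * (s + 1)) % (2 * s)) : i = j := by
  have h1 : i ≡ j [MOD 2 * s] :=
    Nat.ModEq.cancel_right_of_coprime (coprime_aux s k hs) h
  unfold Nat.ModEq at h1
  rwa [Nat.mod_eq_of_lt hi, Nat.mod_eq_of_lt hj] at h1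

theorem kappa_upper (s k : ℕ) (hs : s = 2 * k) (hk : 2 ≤ k) (lam : NPartition)
    (h1 : lam.IsCore (s - 1)) (h2 : lam.IsCore (s + 1)) :
    24 * (lam.size : ℤ) ≤ 16 * (k : ℤ) ^ 2 * ((k : ℤ) ^ 2 - 1) := by
  obtain ⟨X, hX⟩ := exists_rep lam
  have c1 := (hX.1 _ (by omega)).1 h1
  have c2 := (hX.1 _ (by omega)).1 h2
  have c3 : Closed (2 * s) X := by
    intro x hx hsx
    have a := c1 _ (c2 x hx (by omega)) (by omega)
    rwa [show x - (s + 1) - (s - 1) = x - 2 * s by omega] at a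
  have hn : 0 < 2 * s := by omega
  obtain ⟨g, g1, g2, g3, g4, g5⟩ := exists_firstGap (2 * s) hn X
  have hsz := size_formula lam X hX (2 * s) hn c3 (fun j => g (j * (s + 1)))
    (fun j _ => g2 _) (fun j _ => g3 _) (by
      intro i hi j hj h
      rw [g1, g1] at h
      exact inj_aux s k hs i j hi hj h)
  obtain ⟨β, hβ⟩ : ∃ β : ℕ → ℕ, β = fun j => g (j * (s + 1)) := ⟨_, rfl⟩
  have hup : ∀ j, β (j + 1) ≤ β j + (s + 1) := by
    intro j
    have := g5 _ c2 (j * (s + 1))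
    rw [show j * (s + 1) + (s + 1) = (j + 1) * (s + 1) by ring] at this
    rw [hβ]; exact this
  have hdn : ∀ j, β j ≤ β (j + 1) + (s - 1) := by
    intro j
    have := g5 _ c1 ((j + 1) * (s + 1))
    rw [show (j + 1) * (s + 1) + (s - 1) = j * (s + 1) + 2 * s by
      rw [add_mul]; omega] at this
    rw [hβ]
    rwa [g4 (j * (s + 1) + 2 * s) (j * (s + 1)) (by simp)] at this
  have hdich : ∀ j, β (j + 1) = β j + (s + 1) ∨ β (j + 1) + (s - 1) = β j := by
    intro j
    have e : β (j + 1) ≡ β j + (s + 1) [MOD 2 * s] := by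
      rw [hβ]
      show g ((j + 1) * (s + 1)) % (2 * s) = (g (j * (s + 1)) + (s + 1)) % (2 * s)
      rw [g1, Nat.add_mod, g1, ← Nat.add_mod]
      congr 1
      ring
    have d := (Nat.modEq_iff_dvd' (hup j)).1 e
    obtain ⟨t, ht⟩ := d
    have u1 := hup j
    have u2 := hdn j
    have : t < 2 := by
      by_contra hc
      have : 2 * s * 2 ≤ 2 * s * t := Nat.mul_le_mul_left _ (by omega)
      omega
    interval_cases t
    · left; omega
    · right; omega
  have hstep : ∀ j < 2 * s, ((β (j + 1) : ℕ) : ℤ) = β j + (((2 * s : ℕ) : ℤ) *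
      ((if j ∈ (Finset.range (2 * s)).filter (fun j => β (j + 1) = β j + (s + 1))
        then 1 else 0) + (if j ∈ (∅ : Finset ℕ) then 1 else 0)) - ((s - 1 : ℕ) : ℤ)) := by
    intro j hj
    simp only [Finset.mem_filter, Finset.mem_range, hj, true_and, Finset.notMem_empty, if_false,
      add_zero]
    by_cases h : β (j + 1) = β j + (s + 1)
    · simp only [h, if_true]; omega
    · simp only [h, if_false]
      have := hdich j
      omega
  have hAn : ∀ p ∈ (Finset.range (2 * s)).filter (fun j => β (j + 1) = β j + (s + 1)),
      p < 2 * s := fun p hp => Finset.mem_range.1 (Finset.mem_filter.1 hp).1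
  generalize (Finset.range (2 * s)).filter (fun j => β (j + 1) = β j + (s + 1)) = A at *
  have hcard := card_of_steps (2 * s) (s - 1) hn (fun j => (β j : ℤ)) A ∅ hAn (by simp) hstep
    (by rw [hβ]; simp only [zero_mul, Nat.cast_inj]; exact g4 _ _ (by simp))
  have hsaw := eq_saw (2 * s) (s - 1) (fun j => (β j : ℤ)) A ∅ hcard
    (fun j hj => hstep j (by omega))
  have hcov := cov_congr_shift (2 * s) (fun j => (β j : ℤ)) (saw (2 * s) A) _
    (fun i hi => by rw [hsaw i hi]; simp [saw]; rfl)
  have hle := cov_saw_le (2 * s) A hAn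
  have hβ' : ∀ j, g (j * (s + 1)) = β j := fun j => by rw [hβ]
  simp only [hβ'] at hsz
  have hc2 : (A.card : ℤ) = 2 * k - 1 := by
    simp at hcard; omega
  have hcc : ((2 * s : ℕ) : ℤ) = 4 * k := by omega
  rw [← hcov, hc2, hcc] at hle
  rw [hcc] at hsz
  unfold arc at hle
  have hkk : (0 : ℤ) < (4 * k) ^ 2 := by positivity
  refine le_of_mul_le_mul_left ?_ hkk
  nlinarith

theorem arc_mono_aux (K r : ℤ) (hr : 1 ≤ r) (hrk : r + 1 ≤ K) :
    2 * arc (2 * K) (K + r) + 2 * arc (2 * K) (K - 1 - r)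
      ≤ (2 * K) ^ 2 * (4 * K ^ 4 - 1) := by
  have e : ∀ x : ℤ, arc (2 * K) (K + x) = (2 * K) ^ 2 * ((K ^ 2 - x ^ 2) * (K ^ 2 - x ^ 2 + 2)) := by
    intro x; unfold arc; ring
  rw [show K - 1 - r = K + (-1 - r) by ring, e, e]
  have hm : ∀ w W : ℤ, 0 ≤ w → w ≤ W → w * (w + 2) ≤ W * (W + 2) := by
    intro w W h1 h2; nlinarith
  have a := hm (K ^ 2 - r ^ 2) (K ^ 2 - 1) (by nlinarith) (by nlinarith)
  have b := hm (K ^ 2 - (-1 - r) ^ 2) (K ^ 2 - 4) (by nlinarith) (by nlinarith)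
  have hK : 2 ≤ K := by linarith
  have hfin : 2 * ((K ^ 2 - r ^ 2) * (K ^ 2 - r ^ 2 + 2))
      + 2 * ((K ^ 2 - (-1 - r) ^ 2) * (K ^ 2 - (-1 - r) ^ 2 + 2)) ≤ 4 * K ^ 4 - 1 := by
    nlinarith
  have := mul_le_mul_of_nonneg_left hfin (sq_nonneg (2 * K))
  linarith

theorem mu_upper (s k : ℕ) (hs : s = 2 * k) (hk : 2 ≤ k) (lam : NPartition)
    (h1 : lam.IsCore (s - 1)) (h3 : lam.IsCore s) (h2 : lam.IsCore (s + 1)) :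
    24 * (lam.size : ℤ) ≤ 4 * (k : ℤ) ^ 2 * ((k : ℤ) ^ 2 - 1) := by
  obtain ⟨X, hX⟩ := exists_rep lam
  have c1 := (hX.1 _ (by omega)).1 h1
  have c2 := (hX.1 _ (by omega)).1 h2
  have hn : 0 < s := by omega
  have c3 := (hX.1 _ hn).1 h3
  obtain ⟨β, g1, g2, g3, g4, g5⟩ := exists_firstGap s hn X
  have hsz := size_formula lam X hX s hn c3 β
    (fun j _ => g2 _) (fun j _ => g3 _) (by
      intro i hi j hj h
      rwa [g1, g1, Nat.mod_eq_of_lt hi, Nat.mod_eq_of_lt hj] at h)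
  have hup : ∀ j, β (j + 1) ≤ β j + (s + 1) := by
    intro j
    have := g5 _ c2 j
    rwa [g4 (j + (s + 1)) (j + 1) (by
      rw [show j + (s + 1) = j + 1 + s by ring]; simp)] at this
  have hdn : ∀ j, β j ≤ β (j + 1) + (s - 1) := by
    intro j
    have := g5 _ c1 (j + 1)
    rwa [g4 (j + 1 + (s - 1)) j (by
      rw [show j + 1 + (s - 1) = j + s by omega]; simp)] at this
  have htri : ∀ j, β (j + 1) = β j + (s + 1) ∨ β (j + 1) = β j + 1 ∨
      β (j + 1) + (s - 1) = β j := by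
    intro j
    have e : β (j + 1) ≡ β j + (s + 1) [MOD s] := by
      show β (j + 1) % s = (β j + (s + 1)) % s
      rw [g1, Nat.add_mod (β j), g1, ← Nat.add_mod, show j + (s + 1) = j + 1 + s by ring]
      simp
    have d := (Nat.modEq_iff_dvd' (hup j)).1 e
    obtain ⟨t, ht⟩ := d
    have u1 := hup j
    have u2 := hdn j
    have : t < 3 := by
      by_contra hc
      have : s * 3 ≤ s * t := Nat.mul_le_mul_left _ (by omega)
      omega
    interval_cases t
    · left; omega
    · right; left; omega
    · right; right; omega
  obtain ⟨A, hAd⟩ : ∃ A, A = (Finset.range s).filter (fun j => β j < β (j + 1)) := ⟨_, rfl⟩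
  obtain ⟨B, hBd⟩ : ∃ B, B = (Finset.range s).filter (fun j => β (j + 1) = β j + (s + 1)) :=
    ⟨_, rfl⟩
  have hstep : ∀ j < s, ((β (j + 1) : ℕ) : ℤ) = β j + ((s : ℤ) *
      ((if j ∈ A then 1 else 0) + (if j ∈ B then 1 else 0)) - ((s - 1 : ℕ) : ℤ)) := by
    intro j hj
    rw [hAd, hBd]
    simp only [Finset.mem_filter, Finset.mem_range, hj, true_and]
    rcases htri j with h | h | h
    · rw [if_pos (by omega), if_pos h]; omega
    · rw [if_pos (by omega), if_neg (by omega)]; omega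
    · rw [if_neg (by omega), if_neg (by omega)]; omega
  have hAn : ∀ p ∈ A, p < s := fun p hp => by
    rw [hAd] at hp; exact Finset.mem_range.1 (Finset.mem_filter.1 hp).1
  have hBn : ∀ p ∈ B, p < s := fun p hp => by
    rw [hBd] at hp; exact Finset.mem_range.1 (Finset.mem_filter.1 hp).1
  have hBA : B ⊆ A := by
    intro p hp
    rw [hBd, Finset.mem_filter] at hp
    rw [hAd, Finset.mem_filter]
    exact ⟨hp.1, by omega⟩
  have hcard := card_of_steps s (s - 1) hn (fun j => (β j : ℤ)) A B hAn hBn hstep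
    (by simp only [Nat.cast_inj]; exact g4 _ _ (by simp))
  have hsaw := eq_saw s (s - 1) (fun j => (β j : ℤ)) A B hcard
    (fun j hj => hstep j (by omega))
  have hcov := cov_congr_shift s (fun j => (β j : ℤ)) (fun i => saw s A i + saw s B i) _ hsaw
  have hpar := cov_parallelogram s (saw s A) (saw s B) (fun i => saw s A i + saw s B i)
    (saw s (A \ B)) (fun _ _ => rfl) (fun i _ => by
      unfold saw; rw [← Finset.sum_sdiff hBA]; ring)
  have hleA := cov_saw_le s A hAn
  have hleB := cov_saw_le s B hBn
  have hZ : (A \ B).card + B.card = A.card := Finset.card_sdiff_add_card_eq_card hBA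
  have main : 12 * cov s (fun j => (β j : ℤ)) (fun j => (β j : ℤ))
      ≤ (2 * (k : ℤ)) ^ 2 * (4 * (k : ℤ) ^ 4 - 1) := by
    rw [hcov, hpar]
    have hsk : (s : ℤ) = 2 * k := by omega
    by_cases hz : (A \ B).card = 1
    · obtain ⟨p, hp⟩ := Finset.card_eq_one.1 hz
      have hps : p < s := hAn p (Finset.sdiff_subset (hp ▸ Finset.mem_singleton_self p))
      have hs1 := cov_saw_single s p hps
      rw [hp]
      have hA' : (A.card : ℤ) = k := by omega
      have hB' : (B.card : ℤ) = k - 1 := by omega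
      rw [hA', hsk] at hleA
      rw [hB', hsk] at hleB
      rw [hsk] at hs1
      unfold arc at hleA hleB
      linarith
    · have hnn := cov_self_nonneg s (saw s (A \ B))
      have hA' : (A.card : ℤ) = k + ((A.card : ℤ) - k) := by ring
      have hB' : (B.card : ℤ) = k - 1 - ((A.card : ℤ) - k) := by omega
      have := arc_mono_aux k ((A.card : ℤ) - k) (by omega) (by omega)
      rw [← hA', ← hB'] at this
      rw [hsk] at hleA hleB
      linarith
  have hsk : (s : ℤ) = 2 * k := by omega
  rw [hsk] at hsz
  have hkk : (0 : ℤ) < (2 * k) ^ 2 := by positivity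
  refine le_of_mul_le_mul_left ?_ hkk
  linarith

end CoreMax

namespace CoreMax

theorem construct (n : ℕ) (hn : 0 < n) (β : ℕ → ℕ)
    (hinj : ∀ i < n, ∀ j < n, β i % n = β j % n → i = j) :
    ∃ lam : NPartition,
      (∀ m, 0 < m → (∀ j < n, ∃ i < n, ∃ t, β j + m = β i + n * t) → lam.IsCore m) ∧
      24 * (n : ℤ) ^ 2 * lam.size
        = 12 * cov n (fun j => (β j : ℤ)) (fun j => (β j : ℤ))
          - (n : ℤ) ^ 2 * ((n : ℤ) ^ 2 - 1) := by
  classical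
  have him : (Finset.range n).image (fun j => β j % n) = Finset.range n := by
    apply Finset.eq_of_subset_of_card_le
    · intro x hx
      obtain ⟨j, -, rfl⟩ := Finset.mem_image.1 hx
      exact Finset.mem_range.2 (Nat.mod_lt _ hn)
    · rw [Finset.card_image_of_injOn]
      intro a ha b hb hab
      simp only [Finset.coe_range, Set.mem_Iio] at ha hb
      exact hinj a ha b hb hab
  obtain ⟨X, hXd⟩ : ∃ X, X = (Finset.range (∑ j ∈ Finset.range n, β j)).filter
    (fun y => ¬ ∃ j < n, ∃ t, y = β j + n * t) := ⟨_, rfl⟩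
  have hX : ∀ y, y ∈ X ↔ ¬ ∃ j < n, ∃ t, y = β j + n * t := by
    intro y
    rw [hXd, Finset.mem_filter]
    refine ⟨fun h => h.2, fun h => ⟨?_, h⟩⟩
    by_contra hc
    apply h
    have hy : y % n ∈ (Finset.range n).image (fun j => β j % n) := by
      rw [him]; exact Finset.mem_range.2 (Nat.mod_lt _ hn)
    obtain ⟨j, hj, hjy⟩ := Finset.mem_image.1 hy
    have hle : β j ≤ y :=
      (Finset.single_le_sum (f := β) (fun _ _ => Nat.zero_le _) hj).trans
        (by simpa using hc)
    obtain ⟨t, ht⟩ := (Nat.modEq_iff_dvd' hle).1 hjy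
    exact ⟨j, Finset.mem_range.1 hj, t, by omega⟩
  have hcl : ∀ m, (∀ j < n, ∃ i < n, ∃ t, β j + m = β i + n * t) → Closed m X := by
    intro m hm x hx hmx
    rw [hX] at hx ⊢
    rintro ⟨j, hj, t, ht⟩
    obtain ⟨i, hi, t', ht'⟩ := hm j hj
    exact hx ⟨i, hi, t' + t, by rw [mul_add]; omega⟩
  obtain ⟨lam, hrep⟩ := exists_partition X
  refine ⟨lam, fun m hm h => (hrep.1 m hm).2 (hcl m h), ?_⟩
  apply size_formula lam X hrep n hn (hcl n (fun j hj => ⟨j, hj, 1, by simp⟩)) β _ _ hinj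
  · intro j hj h
    rw [hX] at h
    exact h ⟨j, hj, 0, by simp⟩
  · intro j hj hle
    rw [hX]
    rintro ⟨i, hi, t, ht⟩
    have e : β j = β i + n * (t + 1) := by rw [mul_add]; omega
    have := hinj j hj i hi (by rw [e]; simp)
    subst this
    have : 0 < n * (t + 1) := by positivity
    omega

theorem kappa_lower (s k : ℕ) (hs : s = 2 * k) (hk : 2 ≤ k) :
    ∃ lam : NPartition, lam.IsCore (s - 1) ∧ lam.IsCore (s + 1) ∧
      24 * (lam.size : ℤ) = 16 * (k : ℤ) ^ 2 * ((k : ℤ) ^ 2 - 1) := by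
  have hn : 0 < 2 * s := by omega
  obtain ⟨β, hβ⟩ : ∃ β : ℕ → ℕ, β = fun j => if j < s then j * (s + 1)
    else (2 * s - j) * (s - 1) := ⟨_, rfl⟩
  have b0 : β 0 = 0 := by rw [hβ]; simp; omega
  have bup : ∀ j, j + 1 < s → β (j + 1) = β j + (s + 1) := by
    intro j hj
    rw [hβ]
    simp only [hj, if_true, show j < s by omega]
    ring
  have bdn : ∀ j, s ≤ j + 1 → j < 2 * s → β (j + 1) + (s - 1) = β j := by
    intro j hj hj2
    rw [hβ]
    simp only [show ¬ (j + 1 < s) by omega, if_false]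
    by_cases h : j < s
    · simp only [h, if_true]
      obtain rfl : s = j + 1 := by omega
      rw [show 2 * (j + 1) - (j + 1) = j + 1 by omega, show j + 1 - 1 = j by omega]
      ring
    · simp only [h, if_false]
      rw [show 2 * s - j = (2 * s - (j + 1)) + 1 by omega]
      ring
  have blast : β (2 * s) = 0 := by rw [hβ]; simp; omega
  have hmod : ∀ j < 2 * s, β j % (2 * s) = (j * (s + 1)) % (2 * s) := by
    intro j hj
    induction j with
    | zero => rw [b0]; simp
    | succ j ih =>
      have ih := ih (by omega)
      rw [show (j + 1) * (s + 1) = j * (s + 1) + (s + 1) by ring, Nat.add_mod, ← ih,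
        ← Nat.add_mod]
      by_cases h : j + 1 < s
      · rw [bup j h]
      · rw [← bdn j (by omega) (by omega),
          show β (j + 1) + (s - 1) + (s + 1) = β (j + 1) + 2 * s by omega]
        simp
  obtain ⟨lam, hcore, hsz⟩ := construct (2 * s) hn β (by
    intro i hi j hj h
    rw [hmod i hi, hmod j hj] at h
    exact inj_aux s k hs i j hi hj h)
  refine ⟨lam, hcore _ (by omega) ?_, hcore _ (by omega) ?_, ?_⟩
  · intro j hj
    rcases Nat.eq_zero_or_pos j with h | h
    · subst h
      refine ⟨2 * s - 1, by omega, 0, ?_⟩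
      have := bdn (2 * s - 1) (by omega) (by omega)
      rw [show 2 * s - 1 + 1 = 2 * s by omega, blast] at this
      omega
    · obtain ⟨i, rfl⟩ : ∃ i, j = i + 1 := ⟨j - 1, by omega⟩
      by_cases h2 : i + 1 < s
      · exact ⟨i, by omega, 1, by rw [bup i h2]; omega⟩
      · exact ⟨i, by omega, 0, by rw [bdn i (by omega) (by omega)]; simp⟩
  · intro j hj
    by_cases h : j + 1 = 2 * s
    · refine ⟨0, by omega, 1, ?_⟩
      have := bdn j (by omega) hj
      rw [h, blast] at this
      omega
    · by_cases h2 : j + 1 < s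
      · exact ⟨j + 1, by omega, 0, by rw [bup j h2]; simp⟩
      · exact ⟨j + 1, by omega, 1, by rw [← bdn j (by omega) (by omega)]; omega⟩
  · have hsaw := eq_saw (2 * s) (s - 1) (fun j => (β j : ℤ)) (Finset.range (s - 1)) ∅ (by simp) (by
      intro j hj
      simp only [Finset.mem_range, Finset.notMem_empty, if_false, add_zero]
      by_cases h : j + 1 < s
      · rw [if_pos (by omega), bup j h]; omega
      · rw [if_neg (by omega), ← bdn j (by omega) (by omega)]; omega)
    have hcov := cov_congr_shift (2 * s) (fun j => (β j : ℤ)) (saw (2 * s) (Finset.range (s - 1))) _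
      (fun i hi => by rw [hsaw i hi]; simp [saw]; rfl)
    have hr := cov_saw_range (2 * s) (s - 1) (by omega)
    rw [hcov, hr] at hsz
    have hc2 : ((s - 1 : ℕ) : ℤ) = 2 * k - 1 := by omega
    have hcc : ((2 * s : ℕ) : ℤ) = 4 * k := by omega
    rw [hc2, hcc] at hsz
    unfold arc at hsz
    have hkk : ((4 * k : ℤ)) ^ 2 ≠ 0 := by positivity
    apply mul_left_cancel₀ hkk
    linear_combination hsz

theorem mu_lower (s k : ℕ) (hs : s = 2 * k) (hk : 2 ≤ k) :
    ∃ lam : NPartition, lam.IsCore (s - 1) ∧ lam.IsCore s ∧ lam.IsCore (s + 1) ∧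
      24 * (lam.size : ℤ) = 4 * (k : ℤ) ^ 2 * ((k : ℤ) ^ 2 - 1) := by
  have hn : 0 < s := by omega
  obtain ⟨β, hβ⟩ : ∃ β : ℕ → ℕ, β = fun j => j + s * (if j < k then j else s - 1 - j) :=
    ⟨_, rfl⟩
  have b0 : β 0 = 0 := by rw [hβ]; simp; omega
  have bup : ∀ j, j + 1 < k → β (j + 1) = β j + (s + 1) := by
    intro j hj
    rw [hβ]
    simp only [hj, if_true, show j < k by omega]
    ring
  have bmid : ∀ j, j + 1 = k → β (j + 1) = β j + 1 := by
    intro j hj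
    rw [hβ]
    simp only [show ¬ (j + 1 < k) by omega, show j < k by omega, if_true, if_false]
    rw [show s - 1 - (j + 1) = j by omega]
    ring
  have bdn : ∀ j, k ≤ j → j + 1 < s → β (j + 1) + (s - 1) = β j := by
    intro j hj hj2
    rw [hβ]
    simp only [show ¬ (j + 1 < k) by omega, show ¬ (j < k) by omega, if_false]
    rw [show s - 1 - j = (s - 1 - (j + 1)) + 1 by omega, mul_add]
    omega
  have blast : β (s - 1) = s - 1 := by
    rw [hβ]
    simp only [show ¬ (s - 1 < k) by omega, if_false]
    simp
  have hmod : ∀ j < s, β j % s = j := by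
    intro j hj
    rw [hβ]
    simp only [Nat.add_mul_mod_self_left]
    exact Nat.mod_eq_of_lt hj
  obtain ⟨lam, hcore, hsz⟩ := construct s hn β (by
    intro i hi j hj h
    rwa [hmod i hi, hmod j hj] at h)
  refine ⟨lam, hcore _ (by omega) ?_, hcore _ hn (fun j hj => ⟨j, hj, 1, by simp⟩),
    hcore _ (by omega) ?_, ?_⟩
  · intro j hj
    rcases Nat.eq_zero_or_pos j with h | h
    · subst h
      exact ⟨s - 1, by omega, 0, by rw [blast, b0]; simp⟩
    · obtain ⟨i, rfl⟩ : ∃ i, j = i + 1 := ⟨j - 1, by omega⟩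
      rcases lt_trichotomy (i + 1) k with h2 | h2 | h2
      · exact ⟨i, by omega, 2, by rw [bup i h2]; omega⟩
      · exact ⟨i, by omega, 1, by rw [bmid i h2]; omega⟩
      · exact ⟨i, by omega, 0, by rw [bdn i (by omega) (by omega)]; simp⟩
  · intro j hj
    by_cases h : j + 1 = s
    · refine ⟨0, by omega, 2, ?_⟩
      rw [show j = s - 1 by omega, blast, b0]
      omega
    · rcases lt_trichotomy (j + 1) k with h2 | h2 | h2
      · exact ⟨j + 1, by omega, 0, by rw [bup j h2]; simp⟩
      · exact ⟨j + 1, by omega, 1, by rw [bmid j h2]; omega⟩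
      · exact ⟨j + 1, by omega, 2, by rw [← bdn j (by omega) (by omega)]; omega⟩
  · have hsaw := eq_saw s (s - 1) (fun j => (β j : ℤ)) (Finset.range k) (Finset.range (k - 1))
      (by simp only [Finset.card_range]; omega) (by
      intro j hj
      simp only [Finset.mem_range]
      rcases lt_trichotomy (j + 1) k with h2 | h2 | h2
      · rw [if_pos (by omega), if_pos (by omega), bup j h2]; omega
      · rw [if_pos (by omega), if_neg (by omega), bmid j h2]; omega
      · rw [if_neg (by omega), if_neg (by omega), ← bdn j (by omega) (by omega)]; omega)
    have hcov := cov_congr_shift s (fun j => (β j : ℤ))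
      (fun i => saw s (Finset.range k) i + saw s (Finset.range (k - 1)) i) _ hsaw
    have hpar := cov_parallelogram s (saw s (Finset.range k)) (saw s (Finset.range (k - 1)))
      (fun i => saw s (Finset.range k) i + saw s (Finset.range (k - 1)) i)
      (saw s {k - 1}) (fun _ _ => rfl) (fun i _ => by
        obtain ⟨l, rfl⟩ : ∃ l, k = l + 1 := ⟨k - 1, by omega⟩
        unfold saw
        rw [Finset.sum_range_succ]
        simp)
    have r1 := cov_saw_range s k (by omega)
    have r2 := cov_saw_range s (k - 1) (by omega)
    have r3 := cov_saw_single s (k - 1) (by omega)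
    have hc2 : ((k - 1 : ℕ) : ℤ) = k - 1 := by omega
    have hsk : (s : ℤ) = 2 * k := by omega
    rw [hcov, hpar] at hsz
    rw [hsk] at hsz r1 r2 r3
    rw [hc2] at r2
    unfold arc at r1 r2
    have hkk : ((2 * k : ℤ)) ^ 2 ≠ 0 := by positivity
    apply mul_left_cancel₀ hkk
    linear_combination hsz + 2 * r1 + 2 * r2 - r3

theorem choose_aux (k : ℕ) : 6 * (Nat.choose (k + 1) 3 : ℤ) = (k + 1) * k * (k - 1) := by
  have h2 : ∀ k : ℕ, 2 * (Nat.choose k 2 : ℤ) = k * (k - 1) := by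
    intro k
    induction k with
    | zero => simp
    | succ k ih => rw [Nat.choose_succ_succ' k 1, Nat.choose_one_right]; push_cast; linarith
  induction k with
  | zero => simp [Nat.choose]
  | succ k ih =>
    rw [Nat.choose_succ_succ' (k + 1) 2]
    have := h2 (k + 1)
    push_cast at this ⊢
    linarith

end CoreMax

/-- Let `s = 2k > 2` be even.  Then `|κ_{s-1,s+1}|` equals 4 times the
maximal size of a simultaneous `(s-1, s, s+1)`-core; equivalently,
`|κ_{s-1,s+1}| = 4·k·C(k+1, 3)`. -/
theorem maximal_core_size_four_times (s k : ℕ) (hs : s = 2 * k) (hs2 : 2 < s)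
    (κ μ : NPartition)
    (hκcore : NPartition.IsCore (s - 1) κ ∧ NPartition.IsCore (s + 1) κ)
    (hκmax : ∀ ν : NPartition,
      NPartition.IsCore (s - 1) ν → NPartition.IsCore (s + 1) ν → ν.size ≤ κ.size)
    (hμcore : NPartition.IsCore (s - 1) μ ∧ NPartition.IsCore s μ ∧
      NPartition.IsCore (s + 1) μ)
    (hμmax : ∀ ν : NPartition, NPartition.IsCore (s - 1) ν → NPartition.IsCore s ν →
      NPartition.IsCore (s + 1) ν → ν.size ≤ μ.size) :
    κ.size = 4 * μ.size ∧ κ.size = 4 * (k * Nat.choose (k + 1) 3) := by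
  have hk : 2 ≤ k := by omega
  have u1 := CoreMax.kappa_upper s k hs hk κ hκcore.1 hκcore.2
  have u2 := CoreMax.mu_upper s k hs hk μ hμcore.1 hμcore.2.1 hμcore.2.2
  obtain ⟨κ', a1, a2, a3⟩ := CoreMax.kappa_lower s k hs hk
  obtain ⟨μ', b1, b2, b3, b4⟩ := CoreMax.mu_lower s k hs hk
  have m1 : (κ'.size : ℤ) ≤ κ.size := by exact_mod_cast hκmax κ' a1 a2
  have m2 : (μ'.size : ℤ) ≤ μ.size := by exact_mod_cast hμmax μ' b1 b2 b3
  have hc := CoreMax.choose_aux k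
  have e1 : 24 * (κ.size : ℤ) = 16 * (k : ℤ) ^ 2 * ((k : ℤ) ^ 2 - 1) := by linarith
  have e2 : 24 * (μ.size : ℤ) = 4 * (k : ℤ) ^ 2 * ((k : ℤ) ^ 2 - 1) := by linarith
  have e3 : 24 * ((k : ℤ) * Nat.choose (k + 1) 3) = 4 * (k : ℤ) ^ 2 * ((k : ℤ) ^ 2 - 1) := by
    linear_combination 4 * (k : ℤ) * hc
  constructor
  · have : (κ.size : ℤ) = 4 * μ.size := by linarith
    exact_mod_cast this
  · have : (κ.size : ℤ) = 4 * (k * Nat.choose (k + 1) 3) := by linarith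
    exact_mod_cast this
end
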